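/- arXiv:1610.02982 — 4 statements merged into one kernel-verified Lean document; each statement's English description precedes it below -/
import Mathlib

section
/- Let n ≥ 1, r ≥ 1 and a = (a_1,…,a_r) with a_i ≥ 2 for all i and Σ_{i=1}^r (a_i − 1) = n − 1. Then the number of minimal factorizations of the long cycle c = (1,2,…,n) of type a is n^{r−1}; in particular it depends only on r and not on the individual a_i. -/
open scoped Classical
noncomputable section
namespace MinimalFactorization

open Finset Equiv Equiv.Perm

lemma rel_of_sameCycle {α : Type*} [Finite α] {τ : Perm α} {r : α → α → Prop} (hr : Equivalence r)
    (h : ∀ a, r a (τ a)) {a b : α} (hab : τ.SameCycle a b) : r a b := by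
  obtain ⟨i, -, rfl⟩ := hab.exists_pow_eq'
  clear hab
  induction i with
  | zero => exact hr.refl _
  | succ k ih =>
    rw [pow_succ', Perm.mul_apply]
    exact hr.trans ih (h _)

variable {α : Type*} [Fintype α] [DecidableEq α]

lemma sameCycle_of_sameCycle_mul_swap {π : Perm α} {x y : α} (hxy : π.SameCycle x y) {a b : α}
    (hab : (π * swap x y).SameCycle a b) : π.SameCycle a b := by
  refine rel_of_sameCycle (SameCycle.equivalence π) (fun a ↦ ?_) hab
  rw [Perm.mul_apply, sameCycle_apply_right]
  obtain rfl | hx := eq_or_ne a x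
  · rwa [swap_apply_left]
  obtain rfl | hy := eq_or_ne a y
  · rw [swap_apply_right]; exact hxy.symm
  · rw [swap_apply_of_ne_of_ne hx hy]

/-- `π * swap x y` joins the cycle of `y` to that of `x`. -/
lemma sameCycle_mul_swap_of_not_sameCycle {π : Perm α} {x y : α} (hxy : ¬ π.SameCycle x y) {b : α}
    (hb : π.SameCycle y b) : (π * swap x y).SameCycle x b := by
  have key : ∀ j : ℕ, (π * swap x y).SameCycle x ((π ^ (j + 1)) y) := by
    intro j
    have base : (π * swap x y).SameCycle x (π y) := by
      have : π y = (π * swap x y) x := by simp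
      rw [this, sameCycle_apply_right]
    induction j with
    | zero => simpa using base
    | succ j ih =>
      rw [pow_succ', Perm.mul_apply]
      by_cases h : (π ^ (j + 1)) y = y
      · rwa [h]
      · have hx : (π ^ (j + 1)) y ≠ x := by
          rintro h'
          exact hxy (SameCycle.symm ⟨(j + 1 : ℕ), by rw [zpow_natCast, h']⟩)
        have : π ((π ^ (j + 1)) y) = (π * swap x y) ((π ^ (j + 1)) y) := by
          rw [Perm.mul_apply, swap_apply_of_ne_of_ne hx h]
        rwa [this, sameCycle_apply_right]
  obtain ⟨i, hi, -, rfl⟩ := hb.exists_pow_eq''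
  obtain ⟨j, rfl⟩ := Nat.exists_eq_succ_of_ne_zero hi.ne'
  exact key j

lemma sameCycle_mul_swap_iff {π : Perm α} {x y : α} (hxy : ¬ π.SameCycle x y) (a b : α) :
    (π * swap x y).SameCycle a b ↔ π.SameCycle a b ∨
      (π.SameCycle x a ∨ π.SameCycle y a) ∧ (π.SameCycle x b ∨ π.SameCycle y b) := by
  have hy : ∀ b, π.SameCycle y b → (π * swap x y).SameCycle x b := fun b ↦
    sameCycle_mul_swap_of_not_sameCycle hxy
  have hx : ∀ b, π.SameCycle x b → (π * swap x y).SameCycle x b := fun b hb ↦ by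
    refine (hy y (SameCycle.refl _ _)).trans ?_
    rw [swap_comm]
    exact sameCycle_mul_swap_of_not_sameCycle (fun h ↦ hxy h.symm) hb
  constructor
  · refine rel_of_sameCycle (r := fun a b ↦ π.SameCycle a b ∨
      (π.SameCycle x a ∨ π.SameCycle y a) ∧ (π.SameCycle x b ∨ π.SameCycle y b))
      ⟨fun a ↦ .inl (.refl _ _), fun h ↦ ?_, fun h h' ↦ ?_⟩ fun a ↦ ?_
    · exact h.imp (·.symm) (·.symm)
    · rcases h with h | ⟨h1, h2⟩ <;> rcases h' with h' | ⟨h3, h4⟩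
      · exact .inl (h.trans h')
      · exact .inr ⟨h3.imp (·.trans h.symm) (·.trans h.symm), h4⟩
      · exact .inr ⟨h1, h2.imp (·.trans h') (·.trans h')⟩
      · exact .inr ⟨h1, h4⟩
    · simp only [Perm.mul_apply, sameCycle_apply_right]
      obtain rfl | hx := eq_or_ne a x
      · simp [SameCycle.refl]
      obtain rfl | hy := eq_or_ne a y
      · simp [SameCycle.refl]
      · simp [swap_apply_of_ne_of_ne hx hy, SameCycle.refl]
  · rintro (h | ⟨ha, hb⟩)
    · by_cases hax : π.SameCycle x a
      · exact (hx a hax).symm.trans (hx b (hax.trans h))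
      by_cases hay : π.SameCycle y a
      · exact (hy a hay).symm.trans (hy b (hay.trans h))
      obtain ⟨i, -, rfl⟩ := h.exists_pow_eq'
      induction i with
      | zero => exact .refl _ _
      | succ i ih =>
        refine (ih ⟨i, by simp⟩).trans ?_
        have h1 : (π ^ i) a ≠ x := fun h ↦ hax (SameCycle.symm ⟨i, by simpa using h⟩)
        have h2 : (π ^ i) a ≠ y := fun h ↦ hay (SameCycle.symm ⟨i, by simpa using h⟩)
        have : (π ^ (i + 1)) a = (π * swap x y) ((π ^ i) a) := by
          rw [Perm.mul_apply, swap_apply_of_ne_of_ne h1 h2, pow_succ', Perm.mul_apply]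
        rw [this, sameCycle_apply_right]
    · exact (ha.elim (hx a) (hy a)).symm.trans (hb.elim (hx b) (hy b))

/-- The orbit of `x` under `π`. -/
def orbitFinset (π : Perm α) (x : α) : Finset α := {y | π.SameCycle x y}

lemma mem_orbitFinset {π : Perm α} {x y : α} : y ∈ orbitFinset π x ↔ π.SameCycle x y := by
  simp [orbitFinset]

lemma card_orbitFinset_pos (π : Perm α) (x : α) : (0 : ℝ) < #(orbitFinset π x) := by
  exact_mod_cast card_pos.2 ⟨x, mem_orbitFinset.2 (.refl _ _)⟩

lemma orbitFinset_eq {π : Perm α} {x y : α} (h : π.SameCycle x y) :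
    orbitFinset π y = orbitFinset π x := by
  ext b
  simp only [mem_orbitFinset]
  exact ⟨h.trans, h.symm.trans⟩

/-- The sum of `g (#O)` over the orbits `O` of `π`. -/
def orbitSum (g : ℕ → ℝ) (π : Perm α) : ℝ :=
  ∑ y, g #(orbitFinset π y) / #(orbitFinset π y)

lemma sum_orbitFinset (g : ℕ → ℝ) (π : Perm α) (x : α) :
    ∑ y ∈ orbitFinset π x, g #(orbitFinset π y) / #(orbitFinset π y) = g #(orbitFinset π x) := by
  have : ∀ y ∈ orbitFinset π x, g #(orbitFinset π y) / #(orbitFinset π y) =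
      g #(orbitFinset π x) / #(orbitFinset π x) := fun y hy ↦ by
    rw [orbitFinset_eq (mem_orbitFinset.1 hy)]
  rw [sum_congr rfl this, sum_const, nsmul_eq_mul]
  field_simp [(card_orbitFinset_pos π x).ne']

lemma disjoint_orbitFinset {π : Perm α} {x y : α} (hxy : ¬ π.SameCycle x y) :
    Disjoint (orbitFinset π x) (orbitFinset π y) := by
  rw [Finset.disjoint_left]
  intro b hx hy
  exact hxy ((mem_orbitFinset.1 hx).trans (mem_orbitFinset.1 hy).symm)

lemma orbitFinset_mul_swap {π : Perm α} {x y : α} (hxy : ¬ π.SameCycle x y) {a : α}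
    (ha : a ∈ orbitFinset π x ∪ orbitFinset π y) :
    orbitFinset (π * swap x y) a = orbitFinset π x ∪ orbitFinset π y := by
  ext b
  simp only [mem_union, mem_orbitFinset] at ha
  simp only [mem_union, mem_orbitFinset, sameCycle_mul_swap_iff hxy]
  constructor
  · rintro (h | h)
    · exact ha.imp (·.trans h) (·.trans h)
    · exact h.2
  · exact fun h ↦ .inr ⟨ha, h⟩

lemma orbitFinset_mul_swap_of_notMem {π : Perm α} {x y : α} (hxy : ¬ π.SameCycle x y) {a : α}
    (ha : a ∉ orbitFinset π x ∪ orbitFinset π y) :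
    orbitFinset (π * swap x y) a = orbitFinset π a := by
  ext b
  simp only [mem_union, mem_orbitFinset] at ha
  simp [mem_orbitFinset, sameCycle_mul_swap_iff hxy, ha]

lemma card_orbitFinset_mul_swap {π : Perm α} {x y : α} (hxy : ¬ π.SameCycle x y) :
    #(orbitFinset (π * swap x y) y) = #(orbitFinset π x) + #(orbitFinset π y) := by
  rw [orbitFinset_mul_swap hxy (by simp [mem_orbitFinset, SameCycle.refl]),
    card_union_of_disjoint (disjoint_orbitFinset hxy)]

lemma orbitSum_mul_swap (g : ℕ → ℝ) {π : Perm α} {x y : α} (hxy : ¬ π.SameCycle x y) :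
    orbitSum g (π * swap x y) = orbitSum g π - g #(orbitFinset π x) - g #(orbitFinset π y)
      + g (#(orbitFinset π x) + #(orbitFinset π y)) := by
  have hu : orbitFinset (π * swap x y) y = orbitFinset π x ∪ orbitFinset π y :=
    orbitFinset_mul_swap hxy (by simp [mem_orbitFinset, SameCycle.refl])
  have h1 := sum_orbitFinset g (π * swap x y) y
  rw [card_orbitFinset_mul_swap hxy, hu] at h1
  have h2 := sum_orbitFinset g π x
  have h3 := sum_orbitFinset g π y
  unfold orbitSum
  rw [← sum_add_sum_compl (orbitFinset π x ∪ orbitFinset π y),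
    ← sum_add_sum_compl (orbitFinset π x ∪ orbitFinset π y)
      (fun z ↦ g #(orbitFinset π z) / #(orbitFinset π z)), h1,
    sum_union (disjoint_orbitFinset hxy), h2, h3,
    sum_congr rfl fun z hz ↦ by rw [orbitFinset_mul_swap_of_notMem hxy (mem_compl.1 hz)]]
  ring

/-- The number of orbits of `π`, fixed points included. -/
def numOrbits (π : Perm α) : ℝ := orbitSum (fun _ ↦ 1) π

/-- The product of the sizes of the orbits of `π`. -/
def orbitProd (π : Perm α) : ℝ := Real.exp (orbitSum (fun k ↦ Real.log k) π)

lemma numOrbits_mul_swap {π : Perm α} {x y : α} (hxy : ¬ π.SameCycle x y) :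
    numOrbits (π * swap x y) = numOrbits π - 1 := by
  rw [numOrbits, orbitSum_mul_swap _ hxy, numOrbits]; ring

lemma numOrbits_le_mul_swap {π : Perm α} {x y : α} (hxy : π.SameCycle x y) :
    numOrbits π ≤ numOrbits (π * swap x y) := by
  refine sum_le_sum fun a _ ↦ one_div_le_one_div_of_le (card_orbitFinset_pos _ _) ?_
  exact_mod_cast card_le_card fun b hb ↦
    mem_orbitFinset.2 (sameCycle_of_sameCycle_mul_swap hxy (mem_orbitFinset.1 hb))

lemma orbitProd_mul_swap {π : Perm α} {x y : α} (hxy : ¬ π.SameCycle x y) :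
    orbitProd (π * swap x y) = orbitProd π *
      (1 / #(orbitFinset π x) + 1 / #(orbitFinset π y)) := by
  have hx := card_orbitFinset_pos π x
  have hy := card_orbitFinset_pos π y
  rw [orbitProd, orbitSum_mul_swap _ hxy, Real.exp_add, Real.exp_sub, Real.exp_sub, Nat.cast_add,
    Real.exp_log hx, Real.exp_log hy, Real.exp_log (by positivity), orbitProd]
  field_simp
  ring

lemma sum_one_div_card_orbitFinset_compl (π : Perm α) (x : α) :
    ∑ y ∈ (orbitFinset π x)ᶜ, (1 : ℝ) / #(orbitFinset π y) = numOrbits π - 1 := by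
  have h := sum_orbitFinset (fun _ ↦ 1) π x
  rw [numOrbits, orbitSum, ← sum_add_sum_compl (orbitFinset π x), h]
  ring

lemma sum_orbitProd_mul_swap (π : Perm α) (x : α) (A B : ℝ) :
    ∑ y ∈ (orbitFinset π x)ᶜ, orbitProd (π * swap x y) *
      (A + B * Fintype.card α / #(orbitFinset (π * swap x y) y)) =
    orbitProd π * (A * (numOrbits π - 2) +
      (A + B * (numOrbits π - 1)) * Fintype.card α / #(orbitFinset π x)) := by
  have hx := card_orbitFinset_pos π x
  have key : ∀ y ∈ (orbitFinset π x)ᶜ, orbitProd (π * swap x y) *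
      (A + B * Fintype.card α / #(orbitFinset (π * swap x y) y)) =
      orbitProd π * A / #(orbitFinset π x) + orbitProd π * (A +
        B * Fintype.card α / #(orbitFinset π x)) * (1 / #(orbitFinset π y)) := by
    intro y hy
    have hxy : ¬ π.SameCycle x y := by simpa [mem_orbitFinset] using hy
    have hy := card_orbitFinset_pos π y
    rw [orbitProd_mul_swap hxy, card_orbitFinset_mul_swap hxy, Nat.cast_add]
    field_simp
    ring
  have hc : (#(orbitFinset π x)ᶜ : ℝ) = Fintype.card α - #(orbitFinset π x) := by
    rw [card_compl, Nat.cast_sub (card_le_univ _)]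
  rw [sum_congr rfl key, sum_add_distrib, ← mul_sum, sum_one_div_card_orbitFinset_compl,
    sum_const, nsmul_eq_mul, hc]
  field_simp
  ring

/-- The lists of length `m` without repetitions and without elements of `L`. -/
def nodupLists : ℕ → Finset α → Finset (List α)
  | 0, _ => {[]}
  | m + 1, L => Lᶜ.biUnion fun y ↦ (nodupLists m (insert y L)).image (List.cons y)

lemma sum_nodupLists_succ (m : ℕ) (L : Finset α) (f : List α → ℝ) :
    ∑ l ∈ nodupLists (m + 1) L, f l =
      ∑ y ∈ Lᶜ, ∑ l ∈ nodupLists m (insert y L), f (y :: l) := by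
  rw [nodupLists, sum_biUnion]
  · refine sum_congr rfl fun y _ ↦ sum_image fun _ _ _ _ h ↦ (List.cons.inj h).2
  · intro y _ z _ hyz
    simp only [Function.onFun, Finset.disjoint_left, mem_image]
    rintro _ ⟨l, -, rfl⟩ ⟨l', -, h⟩
    exact hyz (List.cons.inj h).1.symm

lemma mem_nodupLists {m : ℕ} {L : Finset α} {l : List α} :
    l ∈ nodupLists m L ↔ l.length = m ∧ l.Nodup ∧ ∀ y ∈ l, y ∉ L := by
  induction m generalizing L l with
  | zero => cases l <;> simp [nodupLists]
  | succ m ih =>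
    cases l with
    | nil => simp [nodupLists]
    | cons y l =>
      simp only [nodupLists, mem_biUnion, mem_compl, mem_image, ih, List.cons.injEq,
        List.length_cons, List.nodup_cons, List.mem_cons, mem_insert, not_or]
      constructor
      · rintro ⟨y, hy, l, ⟨h1, h2, h3⟩, rfl, rfl⟩
        refine ⟨by rw [h1], ⟨fun h ↦ (h3 _ h).1 rfl, h2⟩, ?_⟩
        rintro z (rfl | hz)
        exacts [hy, (h3 z hz).2]
      · rintro ⟨h1, ⟨h2, h3⟩, h4⟩
        refine ⟨y, h4 y (.inl rfl), l, ⟨by omega, h3, fun z hz ↦ ⟨?_, h4 z (.inr hz)⟩⟩, rfl, rfl⟩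
        rintro rfl
        exact h2 hz

lemma sum_nodupLists_eq_zero {G : Perm α → ℝ} {K : ℝ} (h0 : ∀ π, K < numOrbits π → G π = 0)
    (m : ℕ) (π : Perm α) (x : α) (L : Finset α) (h : K + m < numOrbits π) :
    ∑ l ∈ nodupLists m L, G (π * (x :: l).formPerm) = 0 := by
  induction m generalizing π x L with
  | zero => simpa [nodupLists] using h0 π (by simpa using h)
  | succ m ih =>
    simp only [sum_nodupLists_succ, List.formPerm_cons_cons, ← mul_assoc]
    refine sum_eq_zero fun y _ ↦ ih _ _ _ ?_
    push_cast at h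
    by_cases hxy : π.SameCycle x y
    · linarith [numOrbits_le_mul_swap hxy]
    · linarith [numOrbits_mul_swap hxy]

lemma exists_sum_nodupLists {G : Perm α → ℝ} {K C : ℝ}
    (h0 : ∀ π, K < numOrbits π → G π = 0) (h1 : ∀ π, numOrbits π = K → G π = C * orbitProd π)
    (m : ℕ) : ∃ A B : ℝ, A + B = ∏ j ∈ range m, (K + j) ∧
      B * (K + m - 1) = m * ∏ j ∈ range m, (K + j) ∧
      ∀ (π : Perm α) (x : α) (L : Finset α), L ⊆ orbitFinset π x → numOrbits π = K + m →
        ∑ l ∈ nodupLists m L, G (π * (x :: l).formPerm) =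
          C * (orbitProd π * (A + B * Fintype.card α / #(orbitFinset π x))) := by
  induction m with
  | zero =>
    refine ⟨1, 0, by simp, by simp, fun π x L hL h ↦ ?_⟩
    simpa [nodupLists] using h1 π (by simpa using h)
  | succ m ih =>
    obtain ⟨A, B, hAB, hB, ih⟩ := ih
    refine ⟨A * (K + m - 1), A + B * (K + m), ?_, ?_, fun π x L hL h ↦ ?_⟩
    · rw [prod_range_succ, ← hAB]; ring
    · rw [prod_range_succ]; push_cast
      linear_combination (K + m) * hAB + (K + m) * hB
    · push_cast at h
      simp only [sum_nodupLists_succ, List.formPerm_cons_cons, ← mul_assoc]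
      have hsub : (orbitFinset π x)ᶜ ⊆ Lᶜ := compl_subset_compl.2 hL
      rw [← sum_subset hsub]
      · have h2 : ∀ y ∈ (orbitFinset π x)ᶜ,
            ∑ l ∈ nodupLists m (insert y L), G (π * swap x y * (y :: l).formPerm) =
            C * (orbitProd (π * swap x y) *
              (A + B * Fintype.card α / #(orbitFinset (π * swap x y) y))) := by
          intro y hy
          rw [mem_compl, mem_orbitFinset] at hy
          refine ih _ _ _ ?_ (by rw [numOrbits_mul_swap hy, h]; ring)
          rw [orbitFinset_mul_swap hy (by simp [mem_orbitFinset, SameCycle.refl])]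
          exact insert_subset (by simp [mem_orbitFinset, SameCycle.refl])
            (hL.trans subset_union_left)
        rw [sum_congr rfl h2, ← mul_sum, sum_orbitProd_mul_swap, h]
        ring
      · intro y _ hy
        rw [mem_compl, not_not, mem_orbitFinset] at hy
        exact sum_nodupLists_eq_zero h0 _ _ _ _ (by linarith [numOrbits_le_mul_swap hy])

/-- The cycles of length `k`. -/
def cyclesOfLength (α : Type*) [Fintype α] [DecidableEq α] (k : ℕ) : Finset (Perm α) :=
  {z | z.IsCycle ∧ #z.support = k}

lemma mem_cyclesOfLength {k : ℕ} {z : Perm α} :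
    z ∈ cyclesOfLength α k ↔ z.IsCycle ∧ #z.support = k := by
  simp [cyclesOfLength]

lemma sum_nodupLists_formPerm {k : ℕ} (hk : 2 ≤ k) (f : Perm α → ℝ) :
    ∑ l ∈ nodupLists k (∅ : Finset α), f l.formPerm = k * ∑ z ∈ cyclesOfLength α k, f z := by
  have : k * ∑ z ∈ cyclesOfLength α k, f z =
      ∑ z ∈ cyclesOfLength α k, ∑ _x ∈ z.support, f z := by
    rw [mul_sum]
    refine sum_congr rfl fun z hz ↦ ?_
    rw [sum_const, (mem_cyclesOfLength.1 hz).2, nsmul_eq_mul]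
  rw [this, sum_sigma']
  symm
  refine sum_bij (fun p _ ↦ p.1.toList p.2) ?_ ?_ ?_ ?_
  · rintro ⟨z, x⟩ h
    simp only [mem_sigma, mem_cyclesOfLength, mem_support] at h
    simp [mem_nodupLists, Perm.length_toList, h.1.1.cycleOf_eq h.2, h.1.2, Perm.nodup_toList]
  · rintro ⟨z, x⟩ h ⟨z', x'⟩ h' he
    simp only [mem_sigma, mem_cyclesOfLength, mem_support] at h h' he
    have h1 := congrArg List.formPerm he
    rw [formPerm_toList, formPerm_toList, h.1.1.cycleOf_eq h.2, h'.1.1.cycleOf_eq h'.2] at h1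
    subst h1
    have h2 := congrArg List.head? he
    have hd : ∀ x, z x ≠ x → (z.toList x).head? = some x := fun x hx ↦ by
      have := length_toList_pos_of_mem_support z x (mem_support.2 hx)
      rw [List.head?_eq_getElem?, List.getElem?_eq_getElem this, getElem_toList]
      simp
    rw [hd x h.2, hd x' h'.2] at h2
    simpa using h2
  · intro l hl
    rw [mem_nodupLists] at hl
    have h2 : 2 ≤ l.length := hl.1 ▸ hk
    have hs : l.formPerm.support = l.toFinset :=
      List.support_formPerm_of_nodup _ hl.2.1 (by rintro x rfl; simp at h2)
    refine ⟨⟨l.formPerm, l.get ⟨0, by omega⟩⟩, ?_, toList_formPerm_nontrivial l h2 hl.2.1⟩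
    simp only [mem_sigma, mem_cyclesOfLength]
    refine ⟨⟨List.isCycle_formPerm hl.2.1 h2, ?_⟩, ?_⟩
    · rw [hs, List.toFinset_card_of_nodup hl.2.1, hl.1]
    · rw [hs, List.mem_toFinset]; exact List.get_mem _ _
  · rintro ⟨z, x⟩ h
    simp only [mem_sigma, mem_cyclesOfLength, mem_support] at h
    rw [formPerm_toList, h.1.1.cycleOf_eq h.2]

lemma sum_cyclesOfLength_eq_zero {G : Perm α → ℝ} {K : ℝ}
    (h0 : ∀ π, K < numOrbits π → G π = 0) {m : ℕ} (hm : 1 ≤ m) {π : Perm α}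
    (h : K + m < numOrbits π) : ∑ z ∈ cyclesOfLength α (m + 1), G (π * z) = 0 := by
  have := sum_nodupLists_formPerm (k := m + 1) (by omega) fun z ↦ G (π * z)
  rw [sum_nodupLists_succ, sum_eq_zero fun x _ ↦ sum_nodupLists_eq_zero h0 m π x _ h] at this
  exact (mul_eq_zero.1 this.symm).resolve_left (by positivity)

lemma sum_cyclesOfLength {G : Perm α → ℝ} {K C : ℝ}
    (h0 : ∀ π, K < numOrbits π → G π = 0) (h1 : ∀ π, numOrbits π = K → G π = C * orbitProd π)
    {m : ℕ} (hm : 1 ≤ m) {π : Perm α} (h : numOrbits π = K + m) :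
    ∑ z ∈ cyclesOfLength α (m + 1), G (π * z) =
      C * orbitProd π * Fintype.card α * ∏ j ∈ range m, (K + j) := by
  obtain ⟨A, B, hAB, hB, key⟩ := exists_sum_nodupLists h0 h1 m
  have := sum_nodupLists_formPerm (k := m + 1) (by omega) fun z ↦ G (π * z)
  rw [sum_nodupLists_succ, compl_empty, sum_congr rfl fun x _ ↦ key π x (insert x ∅)
    (by simp [mem_orbitFinset, SameCycle.refl]) h, ← mul_sum, ← mul_sum, sum_add_distrib] at this
  have h2 : ∑ x, B * Fintype.card α / #(orbitFinset π x) = B * Fintype.card α * numOrbits π := by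
    rw [numOrbits, orbitSum, mul_sum]
    exact sum_congr rfl fun x _ ↦ by ring
  rw [h2, sum_const, card_univ, nsmul_eq_mul, h] at this
  have hm' : ((m + 1 : ℕ) : ℝ) ≠ 0 := by positivity
  refine mul_left_cancel₀ hm' (this.symm.trans ?_)
  push_cast
  linear_combination C * orbitProd π * Fintype.card α * (hAB + hB)

lemma sum_piFinset_succ {β : Type*} {r : ℕ} (s : Fin (r + 1) → Finset β)
    (f : (Fin (r + 1) → β) → ℝ) :
    ∑ z ∈ Fintype.piFinset s, f z =
      ∑ x ∈ s 0, ∑ z ∈ Fintype.piFinset (Fin.tail s), f (Fin.cons x z) := by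
  rw [← sum_product']
  refine sum_nbij' (fun z ↦ (z 0, Fin.tail z)) (fun p ↦ Fin.cons p.1 p.2) ?_ ?_ ?_ ?_ ?_
  · intro z hz
    rwa [mem_product, ← Fin.mem_piFinset_iff_zero_tail]
  · rintro ⟨x, z⟩ h
    rwa [Fin.mem_piFinset_iff_zero_tail, Fin.cons_zero, Fin.tail_cons, ← mem_product]
  · simp
  · simp
  · simp

/-- `π` has a single orbit. -/
def IsFull (π : Perm α) : Prop := ∀ x y, π.SameCycle x y

lemma isFull_iff {π : Perm α} : IsFull π ↔ ∀ x, orbitFinset π x = univ := by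
  simp [IsFull, Finset.ext_iff, mem_orbitFinset]

lemma IsFull.orbitSum_eq [Nonempty α] {π : Perm α} (h : IsFull π) (g : ℕ → ℝ) :
    orbitSum g π = g (Fintype.card α) := by
  rw [isFull_iff] at h
  simp only [orbitSum, h, card_univ, sum_const, nsmul_eq_mul]
  field_simp

lemma isFull_of_numOrbits_eq_one [Nonempty α] {π : Perm α} (h : numOrbits π = 1) : IsFull π := by
  rw [isFull_iff]
  intro x
  have hx : numOrbits π - 1 = ∑ y ∈ (orbitFinset π x)ᶜ, (1 : ℝ) / #(orbitFinset π y) :=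
    (sum_one_div_card_orbitFinset_compl π x).symm
  rw [h, sub_self, eq_comm, sum_eq_zero_iff_of_nonneg fun _ _ ↦ by positivity] at hx
  by_contra hne
  obtain ⟨y, hy⟩ := nonempty_iff_ne_empty.2 fun h ↦ hne (compl_eq_empty_iff _ |>.1 h)
  exact absurd (hx y hy) (one_div_pos.2 (card_orbitFinset_pos π y)).ne'

lemma sum_piFinset_cyclesOfLength [Nonempty α] {r : ℕ} (a : Fin r → ℕ) (ha : ∀ i, 2 ≤ a i) :
    (∀ π : Perm α, 1 + ((∑ i, (a i - 1) : ℕ) : ℝ) < numOrbits π →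
      ∑ z ∈ Fintype.piFinset fun i ↦ cyclesOfLength α (a i),
        (if IsFull (π * (List.ofFn z).prod) then (1 : ℝ) else 0) = 0) ∧
    ∀ π : Perm α, numOrbits π = 1 + ((∑ i, (a i - 1) : ℕ) : ℝ) →
      ∑ z ∈ Fintype.piFinset fun i ↦ cyclesOfLength α (a i),
        (if IsFull (π * (List.ofFn z).prod) then (1 : ℝ) else 0) =
      (Fintype.card α : ℝ) ^ r * (∑ i, (a i - 1)).factorial / Fintype.card α * orbitProd π := by
  induction r with
  | zero =>
    constructor
    · intro π h
      have : ¬ IsFull π := fun hf ↦ by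
        simp [numOrbits, hf.orbitSum_eq] at h
      simp [this]
    · intro π h
      have hf : IsFull π := isFull_of_numOrbits_eq_one (by simpa using h)
      have hc : (0 : ℝ) < Fintype.card α := by exact_mod_cast Fintype.card_pos
      simp [hf, orbitProd, hf.orbitSum_eq, Real.exp_log hc, hc.ne']
  | succ r ih =>
    obtain ⟨ih0, ih1⟩ := ih (Fin.tail a) fun i ↦ ha _
    obtain ⟨m, hm⟩ : ∃ m, a 0 = m + 1 := ⟨a 0 - 1, by have := ha 0; omega⟩
    have hm1 : 1 ≤ m := by have := ha 0; omega
    have hs : ∑ i, (a i - 1) = ∑ i, (Fin.tail a i - 1) + m := by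
      rw [Fin.sum_univ_succ, hm, add_comm]; simp [Fin.tail]
    have hc : (Fintype.card α : ℝ) ≠ 0 := by exact_mod_cast Fintype.card_ne_zero
    have ht : Fin.tail (fun i ↦ cyclesOfLength α (a i)) =
      fun i ↦ cyclesOfLength α (Fin.tail a i) := rfl
    simp only [sum_piFinset_succ, List.ofFn_cons, List.prod_cons, ← mul_assoc, hs, hm, ht]
    constructor
    · intro π h
      refine sum_cyclesOfLength_eq_zero ih0 hm1 ?_
      push_cast at h ⊢
      linarith
    · intro π h
      rw [sum_cyclesOfLength ih0 ih1 hm1 (by rw [h]; push_cast; ring),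
        ← Nat.factorial_mul_ascFactorial, Nat.ascFactorial_eq_prod_range]
      push_cast
      simp only [add_comm (1 : ℝ)]
      field_simp
      ring

lemma isFull_iff_mem_cyclesOfLength [Nontrivial α] {π : Perm α} :
    IsFull π ↔ π ∈ cyclesOfLength α (Fintype.card α) := by
  rw [mem_cyclesOfLength, card_eq_iff_eq_univ]
  constructor
  · intro h
    have hne : ∀ x, π x ≠ x := fun x hx ↦ by
      obtain ⟨y, hy⟩ := exists_ne x
      exact hy ((h x y).eq_of_left hx).symm
    obtain ⟨x⟩ : Nonempty α := inferInstance
    exact ⟨⟨x, hne x, fun y _ ↦ h x y⟩, by ext; simp [hne]⟩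
  · rintro ⟨h, hs⟩ x y
    have hne : ∀ x, π x ≠ x := fun x ↦ by rw [← mem_support, hs]; exact mem_univ x
    exact h.sameCycle (hne x) (hne y)

lemma numOrbits_one : numOrbits (1 : Perm α) = Fintype.card α := by
  simp [numOrbits, orbitSum, orbitFinset, sameCycle_one, filter_eq]

lemma orbitProd_one : orbitProd (1 : Perm α) = 1 := by
  simp [orbitProd, orbitSum, orbitFinset, sameCycle_one, filter_eq]

lemma card_filter_prod_eq_of_isConj {r : ℕ} (a : Fin r → ℕ) {σ τ : Perm α} (h : IsConj σ τ) :
    #{z ∈ Fintype.piFinset fun i ↦ cyclesOfLength α (a i) | (List.ofFn z).prod = σ} =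
    #{z ∈ Fintype.piFinset fun i ↦ cyclesOfLength α (a i) | (List.ofFn z).prod = τ} := by
  obtain ⟨g, rfl⟩ := isConj_iff.1 h
  have hprod : ∀ (z : Fin r → Perm α) (g : Perm α),
      (List.ofFn fun i ↦ g * z i * g⁻¹).prod = g * (List.ofFn z).prod * g⁻¹ := fun z g ↦ by
    have := map_list_prod (MulAut.conj g) (List.ofFn z)
    rw [List.map_ofFn] at this
    exact this.symm
  have hmem : ∀ (z : Fin r → Perm α) (g : Perm α),
      (∀ i, z i ∈ cyclesOfLength α (a i)) → ∀ i, g * z i * g⁻¹ ∈ cyclesOfLength α (a i) :=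
    fun z g hz i ↦ by
      have := mem_cyclesOfLength.1 (hz i)
      exact mem_cyclesOfLength.2 ⟨this.1.conj, by rw [card_support_conj, this.2]⟩
  refine card_bij' (fun z _ i ↦ g * z i * g⁻¹) (fun z _ i ↦ g⁻¹ * z i * g⁻¹⁻¹) ?_ ?_ ?_ ?_
  · intro z hz
    rw [mem_filter, Fintype.mem_piFinset] at hz ⊢
    exact ⟨hmem z g hz.1, by rw [hprod, hz.2]⟩
  · intro z hz
    rw [mem_filter, Fintype.mem_piFinset] at hz ⊢
    exact ⟨hmem z g⁻¹ hz.1, by rw [hprod, hz.2]; group⟩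
  · intro z _; funext i; group
  · intro z _; funext i; group

lemma card_cyclesOfLength_card [Nontrivial α] :
    (#(cyclesOfLength α (Fintype.card α)) : ℝ) = (Fintype.card α - 1).factorial := by
  have h2 : 1 < Fintype.card α := Fintype.one_lt_card
  have h := (sum_piFinset_cyclesOfLength (α := α) (fun _ : Fin 1 ↦ Fintype.card α)
    fun _ ↦ h2).2 1 (by rw [numOrbits_one]; simp [Nat.cast_sub h2.le])
  simp only [sum_piFinset_succ] at h
  have hc : (Fintype.card α : ℝ) ≠ 0 := by positivity
  simp [isFull_iff_mem_cyclesOfLength, orbitProd_one, hc] at h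
  simpa using h

lemma card_filter_prod_eq [Nontrivial α] {r : ℕ} (a : Fin r → ℕ) (ha : ∀ i, 2 ≤ a i)
    (hsum : ∑ i, (a i - 1) = Fintype.card α - 1) {c : Perm α}
    (hc : c ∈ cyclesOfLength α (Fintype.card α)) :
    (#{z ∈ Fintype.piFinset fun i ↦ cyclesOfLength α (a i) | (List.ofFn z).prod = c} : ℝ) =
      (Fintype.card α : ℝ) ^ r / Fintype.card α := by
  have h2 : 1 < Fintype.card α := Fintype.one_lt_card
  have h := (sum_piFinset_cyclesOfLength (α := α) a ha).2 1
    (by rw [numOrbits_one, hsum]; simp [Nat.cast_sub h2.le])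
  rw [sum_boole, hsum, orbitProd_one, card_eq_sum_card_fiberwise
    (f := fun z ↦ (List.ofFn z).prod) (t := cyclesOfLength α (Fintype.card α))] at h
  · have hfib : ∀ σ ∈ cyclesOfLength α (Fintype.card α),
        #{z ∈ {z ∈ Fintype.piFinset fun i ↦ cyclesOfLength α (a i) |
          IsFull (1 * (List.ofFn z).prod)} | (List.ofFn z).prod = σ} =
        #{z ∈ Fintype.piFinset fun i ↦ cyclesOfLength α (a i) | (List.ofFn z).prod = c} := by
      intro σ hσ
      have hconj : IsConj σ c := by
        rw [mem_cyclesOfLength] at hσ hc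
        exact (hσ.1.isConj_iff hc.1).2 (hσ.2.trans hc.2.symm)
      rw [← card_filter_prod_eq_of_isConj a hconj, filter_filter]
      congr 1
      refine filter_congr fun z _ ↦ ⟨And.right, fun hz ↦ ⟨?_, hz⟩⟩
      rwa [one_mul, hz, isFull_iff_mem_cyclesOfLength]
    rw [sum_congr rfl hfib, sum_const, smul_eq_mul, Nat.cast_mul, card_cyclesOfLength_card] at h
    have hf : ((Fintype.card α - 1).factorial : ℝ) ≠ 0 := by positivity
    refine mul_left_cancel₀ hf (h.trans ?_)
    ring
  · intro z hz
    rw [coe_filter, Set.mem_ofPred_eq, one_mul, isFull_iff_mem_cyclesOfLength] at hz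
    exact hz.2

end MinimalFactorization

/-- The number of minimal factorizations of the long cycle `(1,2,…,n)` into a product of
cycles of lengths `a_1, …, a_r` (where `a_i ≥ 2` and `Σ (a_i - 1) = n - 1`) is `n^(r-1)`. -/
theorem card_minimal_factorizations (n r : ℕ) (hn : 1 ≤ n) (hr : 1 ≤ r) (a : Fin r → ℕ)
    (ha : ∀ i, 2 ≤ a i) (hsum : ∑ i, (a i - 1) = n - 1) :
    Set.ncard {z : Fin r → Equiv.Perm (Fin n) |
        (List.ofFn z).prod = finRotate n ∧
        ∀ i, (z i).IsCycle ∧ (z i).support.card = a i} = n ^ (r - 1) := by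
  obtain ⟨r, rfl⟩ := Nat.exists_eq_add_of_le' hr
  have h2 : 2 ≤ n := by
    have h0 := ha 0
    have := Finset.single_le_sum (f := fun i ↦ a i - 1) (fun _ _ ↦ Nat.zero_le _)
      (Finset.mem_univ 0)
    simp only [hsum] at this
    omega
  obtain ⟨n, rfl⟩ := Nat.exists_eq_add_of_le' h2
  have hc : finRotate (n + 2) ∈
      MinimalFactorization.cyclesOfLength (Fin (n + 2)) (Fintype.card (Fin (n + 2))) :=
    MinimalFactorization.mem_cyclesOfLength.2 ⟨isCycle_finRotate, by simp [support_finRotate]⟩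
  have h := MinimalFactorization.card_filter_prod_eq a ha (by simpa using hsum) hc
  rw [pow_succ, mul_div_cancel_right₀ _ (by simp; positivity), Fintype.card_fin] at h
  rw [Nat.add_sub_cancel]
  have h' := Nat.cast_injective (R := ℝ) (h.trans (Nat.cast_pow _ _).symm)
  rw [← h', ← Set.ncard_coe_finset]
  congr 1
  ext z
  simp [MinimalFactorization.mem_cyclesOfLength, and_comm]
end
end

section
/- Let n ≥ 1. The number of (n−1)-tuples (t_1,…,t_{n−1}) of transpositions in the symmetric group S_n whose product satisfies t_1 t_2 ⋯ t_{n−1} = (1,2,…,n) is n^{n−2}. -/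
open scoped Classical

noncomputable section
section

open Finset Equiv Equiv.Perm

theorem isSwap_mul_self {α : Type*} {τ : Perm α} (h : τ.IsSwap) : τ * τ = 1 := by
  obtain ⟨x, y, -, rfl⟩ := h
  exact swap_mul_self x y

variable {α : Type*} [Fintype α]

/-- The cycle of `σ` through `a`, as a finset; fixed points form singleton cycles. -/
def orbitFinset (σ : Perm α) (a : α) : Finset α := {b | σ.SameCycle a b}

/-- The finset of all cycles of `σ`, fixed points included. -/
def orbitFinsets (σ : Perm α) : Finset (Finset α) := univ.image (orbitFinset σ)

/-- The product of the lengths of the cycles of `σ`. -/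
def orbitWeight (σ : Perm α) : ℚ := ∏ X ∈ orbitFinsets σ, (#X : ℚ)

theorem mem_orbitFinset {σ : Perm α} {a b : α} : b ∈ orbitFinset σ a ↔ σ.SameCycle a b := by
  simp [orbitFinset]

theorem orbitFinset_eq_iff {σ : Perm α} {a b : α} :
    orbitFinset σ a = orbitFinset σ b ↔ σ.SameCycle a b := by
  constructor
  · intro h
    rw [← mem_orbitFinset, h, mem_orbitFinset]
  · intro h
    ext c
    rw [mem_orbitFinset, mem_orbitFinset]
    exact ⟨h.symm.trans, h.trans⟩

theorem card_orbitFinset_ne_zero (σ : Perm α) (a : α) : (#(orbitFinset σ a) : ℚ) ≠ 0 := by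
  have : a ∈ orbitFinset σ a := mem_orbitFinset.2 (SameCycle.refl _ _)
  exact_mod_cast (card_pos.2 ⟨a, this⟩).ne'

theorem SameCycle.of_rel {σ : Perm α} {r : α → α → Prop} (hr : Equivalence r)
    (h : ∀ a, r a (σ a)) {a b : α} (hab : σ.SameCycle a b) : r a b := by
  obtain ⟨k, -, rfl⟩ := hab.exists_pow_eq'
  induction k with
  | zero => exact hr.refl _
  | succ k ih => rw [pow_succ', mul_apply]; exact hr.trans (ih ⟨k, by simp⟩) (h _)

theorem sameCycle_mul_swap_self {σ : Perm α} {x y : α} (hxy : ¬ σ.SameCycle x y) :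
    (σ * swap x y).SameCycle x y := by
  have hex : ∃ k, 0 < k ∧ (σ ^ k) y = y := by
    obtain ⟨k, hk, -, h⟩ := (SameCycle.refl σ y).exists_pow_eq
    exact ⟨k, hk, h⟩
  have key : ∀ k, k + 1 ≤ Nat.find hex →
      ((σ * swap x y) ^ (k + 1)) x = (σ ^ (k + 1)) y := by
    intro k
    induction k with
    | zero => simp
    | succ k ih =>
      intro hk
      rw [pow_succ', mul_apply, ih (by omega), pow_succ' σ (k + 1), mul_apply, mul_apply,
        swap_apply_of_ne_of_ne]
      · intro h
        exact hxy (SameCycle.symm ⟨(k + 1 : ℕ), by rw [zpow_natCast]; exact h⟩)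
      · intro h
        exact Nat.find_min hex (m := k + 1) (by omega) ⟨by omega, h⟩
  obtain ⟨hpos, hfix⟩ := Nat.find_spec hex
  obtain ⟨k, hk⟩ := Nat.exists_eq_succ_of_ne_zero hpos.ne'
  refine ⟨(k + 1 : ℕ), ?_⟩
  rw [zpow_natCast, key k (by omega)]
  rw [hk] at hfix
  exact hfix

theorem sameCycle_mul_swap_of_sameCycle {σ : Perm α} {x y a b : α} (hxy : ¬ σ.SameCycle x y)
    (hab : σ.SameCycle a b) : (σ * swap x y).SameCycle a b := by
  have hs := sameCycle_mul_swap_self hxy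
  refine SameCycle.of_rel (SameCycle.equivalence _) (fun a => ?_) hab
  by_cases hx : a = x
  · subst hx
    exact hs.trans ⟨1, by simp⟩
  by_cases hy : a = y
  · subst hy
    exact hs.symm.trans ⟨1, by simp⟩
  exact ⟨1, by simp [swap_apply_of_ne_of_ne hx hy]⟩

theorem sameCycle_mul_swap_iff {σ : Perm α} {x y a b : α} (hxy : ¬ σ.SameCycle x y) :
    (σ * swap x y).SameCycle a b ↔ σ.SameCycle a b ∨
      ((σ.SameCycle x a ∨ σ.SameCycle y a) ∧ (σ.SameCycle x b ∨ σ.SameCycle y b)) := by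
  constructor
  · refine SameCycle.of_rel
      (r := fun a b => σ.SameCycle a b ∨
        ((σ.SameCycle x a ∨ σ.SameCycle y a) ∧ (σ.SameCycle x b ∨ σ.SameCycle y b)))
      ⟨fun a => .inl (SameCycle.refl _ _), ?_, ?_⟩ ?_
    · rintro a b (h | h)
      · exact .inl h.symm
      · exact .inr h.symm
    · rintro a b c (h | h) (h' | h')
      · exact .inl (h.trans h')
      · exact .inr ⟨h'.1.imp (·.trans h.symm) (·.trans h.symm), h'.2⟩
      · exact .inr ⟨h.1, h.2.imp (·.trans h') (·.trans h')⟩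
      · exact .inr ⟨h.1, h'.2⟩
    · intro a
      by_cases hx : a = x
      · subst hx
        exact .inr ⟨.inl (SameCycle.refl _ _), .inr ⟨1, by simp⟩⟩
      by_cases hy : a = y
      · subst hy
        exact .inr ⟨.inr (SameCycle.refl _ _), .inl ⟨1, by simp⟩⟩
      exact .inl ⟨1, by simp [swap_apply_of_ne_of_ne hx hy]⟩
  · have hs := sameCycle_mul_swap_self hxy
    have hm {a b} := sameCycle_mul_swap_of_sameCycle (a := a) (b := b) hxy
    have hx {c} (h : σ.SameCycle x c ∨ σ.SameCycle y c) : (σ * swap x y).SameCycle x c :=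
      h.elim hm fun h => hs.trans (hm h)
    rintro (h | ⟨ha, hb⟩)
    · exact hm h
    · exact (hx ha).symm.trans (hx hb)

theorem orbitFinsets_mul_swap {σ : Perm α} {x y : α} (hxy : ¬ σ.SameCycle x y) :
    orbitFinsets (σ * swap x y) = insert (orbitFinset σ x ∪ orbitFinset σ y)
      (((orbitFinsets σ).erase (orbitFinset σ x)).erase (orbitFinset σ y)) := by
  have h1 {a} (h : σ.SameCycle x a ∨ σ.SameCycle y a) :
      orbitFinset (σ * swap x y) a = orbitFinset σ x ∪ orbitFinset σ y := by
    ext b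
    simp only [mem_orbitFinset, mem_union, sameCycle_mul_swap_iff hxy]
    exact ⟨fun hb => hb.elim (fun hb => h.imp (·.trans hb) (·.trans hb)) (·.2),
      fun hb => .inr ⟨h, hb⟩⟩
  have h2 {a} (h : ¬ (σ.SameCycle x a ∨ σ.SameCycle y a)) :
      orbitFinset (σ * swap x y) a = orbitFinset σ a := by
    ext b
    simp only [mem_orbitFinset, sameCycle_mul_swap_iff hxy]
    tauto
  ext Z
  simp only [orbitFinsets, mem_image, mem_univ, true_and, mem_insert, mem_erase]
  constructor
  · rintro ⟨a, rfl⟩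
    by_cases h : σ.SameCycle x a ∨ σ.SameCycle y a
    · exact .inl (h1 h)
    · rw [h2 h]
      simp only [ne_eq, orbitFinset_eq_iff]
      exact .inr ⟨fun h' => h (.inr h'.symm), fun h' => h (.inl h'.symm), a, SameCycle.refl _ _⟩
  · rintro (rfl | ⟨hy, hx, a, rfl⟩)
    · exact ⟨x, h1 (.inl (SameCycle.refl _ _))⟩
    · refine ⟨a, h2 ?_⟩
      simp only [ne_eq, orbitFinset_eq_iff] at hx hy
      rintro (h | h)
      · exact hx h.symm
      · exact hy h.symm

theorem orbitFinset_mem_orbitFinsets (σ : Perm α) (a : α) : orbitFinset σ a ∈ orbitFinsets σ :=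
  mem_image_of_mem _ (mem_univ a)

theorem union_notMem_orbitFinsets {σ : Perm α} {x y : α} (hxy : ¬ σ.SameCycle x y) :
    orbitFinset σ x ∪ orbitFinset σ y ∉ orbitFinsets σ := by
  intro h
  obtain ⟨a, -, ha⟩ := mem_image.1 h
  have hx : x ∈ orbitFinset σ a := ha ▸ mem_union_left _ (mem_orbitFinset.2 (SameCycle.refl _ _))
  have hy : y ∈ orbitFinset σ a := ha ▸ mem_union_right _ (mem_orbitFinset.2 (SameCycle.refl _ _))
  exact hxy ((mem_orbitFinset.1 hx).symm.trans (mem_orbitFinset.1 hy))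

theorem card_orbitFinsets_mul_swap {σ : Perm α} {x y : α} (hxy : ¬ σ.SameCycle x y) :
    #(orbitFinsets (σ * swap x y)) + 1 = #(orbitFinsets σ) := by
  have hy : orbitFinset σ y ∈ (orbitFinsets σ).erase (orbitFinset σ x) :=
    mem_erase.2 ⟨fun h => hxy (orbitFinset_eq_iff.1 h.symm), orbitFinset_mem_orbitFinsets σ y⟩
  rw [orbitFinsets_mul_swap hxy, card_insert_of_notMem, card_erase_add_one hy,
    card_erase_add_one (orbitFinset_mem_orbitFinsets σ x)]
  exact fun h => union_notMem_orbitFinsets hxy (mem_of_mem_erase (mem_of_mem_erase h))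

theorem orbitWeight_mul_swap {σ : Perm α} {x y : α} (hxy : ¬ σ.SameCycle x y) :
    orbitWeight (σ * swap x y) =
      orbitWeight σ * ((#(orbitFinset σ x) : ℚ)⁻¹ + (#(orbitFinset σ y) : ℚ)⁻¹) := by
  have hy : orbitFinset σ y ∈ (orbitFinsets σ).erase (orbitFinset σ x) :=
    mem_erase.2 ⟨fun h => hxy (orbitFinset_eq_iff.1 h.symm), orbitFinset_mem_orbitFinsets σ y⟩
  have hdisj : Disjoint (orbitFinset σ x) (orbitFinset σ y) := by
    rw [disjoint_left]
    intro a ha hb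
    exact hxy ((mem_orbitFinset.1 ha).trans (mem_orbitFinset.1 hb).symm)
  have h1 := card_orbitFinset_ne_zero σ x
  have h2 := card_orbitFinset_ne_zero σ y
  rw [orbitWeight, orbitWeight, orbitFinsets_mul_swap hxy, prod_insert,
    ← mul_prod_erase _ _ (orbitFinset_mem_orbitFinsets σ x), ← mul_prod_erase _ _ hy,
    card_union_of_disjoint hdisj]
  · push_cast
    field_simp
    ring
  · exact fun h => union_notMem_orbitFinsets hxy (mem_of_mem_erase (mem_of_mem_erase h))

theorem card_orbitFinsets_le_mul_swap {σ : Perm α} {x y : α} (hxy : σ.SameCycle x y) :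
    #(orbitFinsets σ) ≤ #(orbitFinsets (σ * swap x y)) := by
  have h {a b} (hab : (σ * swap x y).SameCycle a b) : σ.SameCycle a b := by
    refine SameCycle.of_rel (SameCycle.equivalence σ) (fun a => ?_) hab
    by_cases hx : a = x
    · subst hx
      exact hxy.trans ⟨1, by simp⟩
    by_cases hy : a = y
    · subst hy
      exact hxy.symm.trans ⟨1, by simp⟩
    exact ⟨1, by simp [swap_apply_of_ne_of_ne hx hy]⟩
  refine card_le_card_of_surjOn (fun Z => Z.biUnion (orbitFinset σ)) ?_
  intro Z hZ
  obtain ⟨a, -, rfl⟩ := mem_image.1 hZ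
  refine ⟨orbitFinset (σ * swap x y) a, orbitFinset_mem_orbitFinsets _ a, ?_⟩
  ext b
  simp only [mem_biUnion, mem_orbitFinset]
  exact ⟨fun ⟨c, hc, hb⟩ => (h hc).trans hb, fun hb => ⟨a, SameCycle.refl _ _, hb⟩⟩

theorem card_orbitFinsets_mul_swap_iff {σ : Perm α} {x y : α} :
    #(orbitFinsets (σ * swap x y)) + 1 = #(orbitFinsets σ) ↔ ¬ σ.SameCycle x y :=
  ⟨fun h hxy => by have := card_orbitFinsets_le_mul_swap hxy; omega, card_orbitFinsets_mul_swap⟩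

theorem card_orbitFinsets_le_mul_isSwap {σ τ : Perm α} (hτ : τ.IsSwap) :
    #(orbitFinsets σ) ≤ #(orbitFinsets (σ * τ)) + 1 := by
  obtain ⟨x, y, -, rfl⟩ := hτ
  by_cases hxy : σ.SameCycle x y
  · exact (card_orbitFinsets_le_mul_swap hxy).trans (Nat.le_succ _)
  · exact (card_orbitFinsets_mul_swap hxy).ge

theorem sum_inv_card_orbitFinset (σ : Perm α) (x : α) :
    ∑ y, (if σ.SameCycle x y then 0 else (#(orbitFinset σ y) : ℚ)⁻¹) =
      #(orbitFinsets σ) - 1 := by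
  have hfib : ∀ X ∈ orbitFinsets σ, #{y | orbitFinset σ y = X} = #X := by
    intro X hX
    obtain ⟨a, -, rfl⟩ := mem_image.1 hX
    congr 1
    ext b
    simp only [mem_filter, mem_univ, true_and, orbitFinset_eq_iff, mem_orbitFinset]
    exact ⟨SameCycle.symm, SameCycle.symm⟩
  have hx := orbitFinset_mem_orbitFinsets σ x
  let f : Finset α → ℚ := fun X => if orbitFinset σ x = X then 0 else (#X : ℚ)⁻¹
  calc _ = ∑ y, f (orbitFinset σ y) := by
        simp only [f, orbitFinset_eq_iff]
    _ = ∑ X ∈ orbitFinsets σ, (if orbitFinset σ x = X then 0 else 1 : ℚ) := by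
        rw [Finset.sum_comp f]
        refine sum_congr rfl fun X hX => ?_
        rw [hfib X hX]
        dsimp only [f]
        obtain ⟨a, -, rfl⟩ := mem_image.1 hX
        split_ifs
        · simp
        · rw [nsmul_eq_mul, mul_inv_cancel₀ (card_orbitFinset_ne_zero σ a)]
    _ = #(orbitFinsets σ) - 1 := by
        rw [← add_sum_erase _ _ hx, sum_congr rfl (g := fun _ => 1), sum_const,
          card_erase_of_mem hx]
        · have := card_pos.2 ⟨_, hx⟩
          rw [nsmul_one, Nat.cast_sub this]
          simp
        · intro X hX
          exact if_neg (ne_of_mem_erase hX).symm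

theorem two_mul_sum_isSwap (F : Perm α → ℚ) :
    2 * ∑ τ with τ.IsSwap, F τ = ∑ x, ∑ y, if x = y then 0 else F (swap x y) := by
  have hcard : ∀ τ ∈ ({τ | τ.IsSwap} : Finset (Perm α)),
      #{p ∈ ({p | p.1 ≠ p.2} : Finset (α × α)) | swap p.1 p.2 = τ} = 2 := by
    intro τ hτ
    obtain ⟨a, b, hab, rfl⟩ := (mem_filter.1 hτ).2
    rw [card_eq_two]
    refine ⟨(a, b), (b, a), by simp [hab], ?_⟩
    ext ⟨x, y⟩
    simp only [mem_filter, mem_univ, true_and, mem_insert, mem_singleton, Prod.mk.injEq]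
    constructor
    · rintro ⟨hne, h⟩
      have hx := congrArg (· x) h
      simp only [swap_apply_left, swap_apply_def] at hx
      split_ifs at hx <;> grind
    · rintro (⟨rfl, rfl⟩ | ⟨rfl, rfl⟩)
      · exact ⟨hab, rfl⟩
      · exact ⟨hab.symm, swap_comm _ _⟩
  rw [← Fintype.sum_prod_type' (f := fun x y => if x = y then 0 else F (swap x y)), mul_sum]
  have : ∑ p : α × α, (if p.1 = p.2 then 0 else F (swap p.1 p.2)) =
      ∑ p : α × α with p.1 ≠ p.2, F (swap p.1 p.2) := by
    rw [sum_filter]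
    exact sum_congr rfl fun p _ => by simp [ite_not]
  rw [this, ← sum_fiberwise_of_maps_to (t := ({τ | τ.IsSwap} : Finset (Perm α)))
    (g := fun p : α × α => swap p.1 p.2)]
  · refine sum_congr rfl fun τ hτ => ?_
    rw [sum_congr rfl (g := fun _ => F τ), sum_const, hcard τ hτ, nsmul_eq_mul, Nat.cast_ofNat]
    intro p hp
    rw [(mem_filter.1 hp).2]
  · intro p hp
    exact mem_filter.2 ⟨mem_univ _, p.1, p.2, (mem_filter.1 hp).2, rfl⟩

theorem sum_orbitWeight_mul_isSwap (σ : Perm α) :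
    ∑ τ with τ.IsSwap, (if #(orbitFinsets (σ * τ)) + 1 = #(orbitFinsets σ) then
      orbitWeight (σ * τ) else 0) =
      Fintype.card α * (#(orbitFinsets σ) - 1) * orbitWeight σ := by
  have key : ∀ x y, (if x = y then 0 else if #(orbitFinsets (σ * swap x y)) + 1 =
      #(orbitFinsets σ) then orbitWeight (σ * swap x y) else 0) =
      orbitWeight σ * (if σ.SameCycle x y then 0 else (#(orbitFinset σ y) : ℚ)⁻¹) +
      orbitWeight σ * (if σ.SameCycle y x then 0 else (#(orbitFinset σ x) : ℚ)⁻¹) := by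
    intro x y
    simp only [card_orbitFinsets_mul_swap_iff, sameCycle_comm (x := y)]
    by_cases hxy : σ.SameCycle x y
    · simp [hxy]
    · have : x ≠ y := by rintro rfl; exact hxy (SameCycle.refl _ _)
      simp only [this, hxy, if_false, not_false_eq_true, if_true, orbitWeight_mul_swap hxy]
      ring
  have h := two_mul_sum_isSwap (fun τ => if #(orbitFinsets (σ * τ)) + 1 = #(orbitFinsets σ) then
      orbitWeight (σ * τ) else 0)
  simp only [key, sum_add_distrib] at h
  rw [sum_comm (f := fun x y => orbitWeight σ *
    (if σ.SameCycle y x then 0 else (#(orbitFinset σ x) : ℚ)⁻¹))] at h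
  simp only [← mul_sum, sum_inv_card_orbitFinset, sum_const, card_univ, nsmul_eq_mul] at h
  linarith

/-- The sequences of `j` transpositions with product `σ`. -/
def swapFactorizations (j : ℕ) (σ : Perm α) : Finset (Fin j → Perm α) :=
  {t | (List.ofFn t).prod = σ ∧ ∀ i, (t i).IsSwap}

theorem mem_swapFactorizations {j : ℕ} {σ : Perm α} {t : Fin j → Perm α} :
    t ∈ swapFactorizations j σ ↔ (List.ofFn t).prod = σ ∧ ∀ i, (t i).IsSwap := by
  simp [swapFactorizations]

theorem card_swapFactorizations_zero (σ : Perm α) :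
    #(swapFactorizations 0 σ) = if σ = 1 then 1 else 0 := by
  simp [swapFactorizations, eq_comm (a := σ), filter_const]
  split_ifs <;> rfl

theorem snoc_mem_swapFactorizations {j : ℕ} {σ τ : Perm α} {t : Fin j → Perm α} (hτ : τ.IsSwap) :
    (Fin.snoc t τ : Fin (j + 1) → Perm α) ∈ swapFactorizations (j + 1) σ ↔
      t ∈ swapFactorizations j (σ * τ) := by
  rw [mem_swapFactorizations, mem_swapFactorizations, List.ofFn_succ', List.concat_eq_append,
    List.prod_append, List.prod_singleton, Fin.forall_fin_succ']
  simp only [Fin.snoc_castSucc, Fin.snoc_last, hτ, and_true]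
  refine and_congr_left fun _ => ⟨?_, ?_⟩
  · rintro rfl
    rw [mul_assoc, isSwap_mul_self hτ, mul_one]
  · intro h
    rw [h, mul_assoc, isSwap_mul_self hτ, mul_one]

theorem card_swapFactorizations_succ (j : ℕ) (σ : Perm α) :
    #(swapFactorizations (j + 1) σ) =
      ∑ τ with τ.IsSwap, #(swapFactorizations j (σ * τ)) := by
  rw [card_eq_sum_card_fiberwise (f := fun t => t (Fin.last j))
    (t := ({τ | τ.IsSwap} : Finset (Perm α)))]
  · refine sum_congr rfl fun τ hτ => ?_
    replace hτ := (mem_filter.1 hτ).2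
    symm
    refine card_bij (fun (t : Fin j → Perm α) _ => (Fin.snoc t τ : Fin (j + 1) → Perm α))
      ?_ ?_ ?_
    · intro t ht
      exact mem_filter.2 ⟨(snoc_mem_swapFactorizations hτ).2 ht,
        Fin.snoc_last (α := fun _ => Perm α) _ _⟩
    · intro t _ t' _ h
      exact (Fin.snoc_injective2 (α := fun _ => Perm α) h).1
    · intro t ht
      obtain ⟨ht, rfl⟩ := mem_filter.1 ht
      have h := Fin.snoc_init_self t
      exact ⟨Fin.init t, (snoc_mem_swapFactorizations hτ).1 (by rwa [h]), h⟩
  · intro t ht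
    exact mem_filter.2 ⟨mem_univ _, (mem_swapFactorizations.1 ht).2 _⟩

theorem orbitFinsets_one : orbitFinsets (1 : Perm α) = univ.image ({·}) := by
  refine image_congr fun a _ => ?_
  ext b
  simp [mem_orbitFinset, sameCycle_one, eq_comm]

theorem card_orbitFinsets_one : #(orbitFinsets (1 : Perm α)) = Fintype.card α := by
  rw [orbitFinsets_one, card_image_of_injective _ singleton_injective, card_univ]

theorem orbitWeight_one : orbitWeight (1 : Perm α) = 1 := by
  rw [orbitWeight, orbitFinsets_one, prod_image singleton_injective.injOn]
  simp

theorem card_le_of_swapFactorizations {j : ℕ} {σ : Perm α} (h : #(swapFactorizations j σ) ≠ 0) :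
    Fintype.card α ≤ #(orbitFinsets σ) + j := by
  induction j generalizing σ with
  | zero =>
    rw [card_swapFactorizations_zero] at h
    obtain rfl : σ = 1 := by by_contra h'; exact h (if_neg h')
    rw [card_orbitFinsets_one, add_zero]
  | succ j ih =>
    rw [card_swapFactorizations_succ] at h
    obtain ⟨τ, hτ, h⟩ := exists_ne_zero_of_sum_ne_zero h
    replace hτ := (mem_filter.1 hτ).2
    have h1 := ih h
    have h2 := card_orbitFinsets_le_mul_isSwap (σ := σ * τ) hτ
    rw [mul_assoc, isSwap_mul_self hτ, mul_one] at h2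
    omega

/-- Factorizations into `j` transpositions with the largest drop in the number of cycles, weighted
by the product of the cycle lengths. -/
theorem sum_card_swapFactorizations_mul_orbitWeight (j : ℕ) :
    ∑ σ : Perm α, (if #(orbitFinsets σ) + j = Fintype.card α then
      #(swapFactorizations j σ) * orbitWeight σ else 0) =
      ∏ i ∈ range j, ((Fintype.card α : ℚ) * (Fintype.card α - i - 1)) := by
  induction j with
  | zero =>
    simp only [card_swapFactorizations_zero]
    rw [Fintype.sum_eq_single 1]
    · simp [card_orbitFinsets_one, orbitWeight_one]
    · intro σ h
      simp [h]
  | succ j ih =>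
    rw [prod_range_succ, ← ih, sum_mul]
    calc _ = ∑ σ : Perm α, ∑ τ with τ.IsSwap,
          (if #(orbitFinsets σ) + (j + 1) = Fintype.card α then
            #(swapFactorizations j (σ * τ)) * orbitWeight σ else 0) := by
          refine sum_congr rfl fun σ _ => ?_
          rw [card_swapFactorizations_succ]
          split_ifs
          · rw [Nat.cast_sum, sum_mul]
          · simp
      _ = ∑ σ : Perm α, ∑ τ with τ.IsSwap,
          (if #(orbitFinsets (σ * τ)) + (j + 1) = Fintype.card α then
            #(swapFactorizations j σ) * orbitWeight (σ * τ) else 0) := by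
          rw [sum_comm, sum_comm (s := univ)]
          refine sum_congr rfl fun τ hτ => ?_
          refine Fintype.sum_equiv (Equiv.mulRight τ) _ _ fun σ => ?_
          simp [mul_assoc, isSwap_mul_self (mem_filter.1 hτ).2]
      _ = _ := by
          refine sum_congr rfl fun σ _ => ?_
          by_cases h0 : #(swapFactorizations j σ) = 0
          · simp [h0]
          have h1 := card_le_of_swapFactorizations h0
          split_ifs with h
          · have h2 : (#(orbitFinsets σ) : ℚ) + j = Fintype.card α := by exact_mod_cast h
            have h3 := sum_orbitWeight_mul_isSwap σ
            rw [← h2, add_sub_cancel_right, h2, mul_assoc, mul_comm (orbitWeight σ), ← h3, mul_sum]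
            refine sum_congr rfl fun τ _ => ?_
            rw [mul_ite, mul_zero]
            congr 1
            apply propext
            omega
          · rw [zero_mul]
            refine sum_eq_zero fun τ hτ => if_neg ?_
            have := card_orbitFinsets_le_mul_isSwap (σ := σ) (mem_filter.1 hτ).2
            omega

theorem card_swapFactorizations_conj (j : ℕ) (σ g : Perm α) :
    #(swapFactorizations j (g * σ * g⁻¹)) = #(swapFactorizations j σ) := by
  have key : ∀ (σ g : Perm α) (t), t ∈ swapFactorizations j σ →
      (fun i => MulAut.conj g (t i)) ∈ swapFactorizations j (g * σ * g⁻¹) := by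
    intro σ g t ht
    obtain ⟨rfl, h⟩ := mem_swapFactorizations.1 ht
    refine mem_swapFactorizations.2 ⟨?_, fun i => ?_⟩
    · rw [← MulAut.conj_apply, map_list_prod, List.map_ofFn]
      rfl
    · obtain ⟨x, y, hxy, h⟩ := h i
      exact ⟨g x, g y, g.injective.ne hxy, by rw [h, MulAut.conj_apply, swap_apply_apply]⟩
  refine card_nbij' (fun t i => MulAut.conj g⁻¹ (t i)) (fun t i => MulAut.conj g (t i)) ?_
    (key σ g) ?_ ?_
  · intro t ht
    have := key _ g⁻¹ t ht
    simpa [mul_assoc] using this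
  · intro t _
    ext1 i
    simp [mul_assoc]
  · intro t _
    ext1 i
    simp [mul_assoc]

theorem orbitFinsets_eq_singleton_univ [Nonempty α] {σ : Perm α} (h : ∀ a b, σ.SameCycle a b) :
    orbitFinsets σ = {univ} := by
  rw [orbitFinsets, image_congr (g := fun _ => univ), image_const univ_nonempty]
  intro a _
  ext b
  simp [mem_orbitFinset, h a b]

theorem sameCycle_of_card_orbitFinsets_eq_one {σ : Perm α} (h : #(orbitFinsets σ) = 1) (a b : α) :
    σ.SameCycle a b :=
  orbitFinset_eq_iff.1 (card_le_one.1 h.le _ (orbitFinset_mem_orbitFinsets σ a) _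
    (orbitFinset_mem_orbitFinsets σ b))

theorem orbitWeight_of_card_orbitFinsets_eq_one [Nonempty α] {σ : Perm α}
    (h : #(orbitFinsets σ) = 1) : orbitWeight σ = Fintype.card α := by
  rw [orbitWeight, orbitFinsets_eq_singleton_univ (sameCycle_of_card_orbitFinsets_eq_one h),
    prod_singleton, card_univ]

theorem card_orbitFinsets_eq_one_iff [DecidableEq α] [Nontrivial α] (σ : Perm α) :
    #(orbitFinsets σ) = 1 ↔ σ.cycleType = {Fintype.card α} := by
  constructor
  · intro h
    have hs := sameCycle_of_card_orbitFinsets_eq_one h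
    have hne : ∀ a, σ a ≠ a := by
      intro a ha
      obtain ⟨b, hb⟩ := exists_ne a
      exact hb ((hs a b).eq_of_left ha).symm
    obtain ⟨a⟩ : Nonempty α := inferInstance
    have hc : σ.IsCycle := ⟨a, hne a, fun b _ => hs a b⟩
    have hsupp : σ.support = univ := by
      ext b
      simp [hne b]
    rw [hc.cycleType, hsupp, card_univ]
  · intro h
    have hc : σ.IsCycle := card_cycleType_eq_one.1 (by rw [h, Multiset.card_singleton])
    have hsupp : σ.support = univ := by
      rw [← card_eq_iff_eq_univ, ← sum_cycleType, h, Multiset.sum_singleton]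
    have hne : ∀ a, σ a ≠ a := fun a => mem_support.1 (hsupp ▸ mem_univ a)
    rw [orbitFinsets_eq_singleton_univ fun a b => hc.sameCycle (hne a) (hne b), card_singleton]

open scoped Nat in
theorem factorial_mul_card_swapFactorizations [Nontrivial α] {c : Perm α}
    (hc : c.cycleType = {Fintype.card α}) :
    (Fintype.card α - 1)! * #(swapFactorizations (Fintype.card α - 1) c) =
      (Fintype.card α - 1)! * Fintype.card α ^ (Fintype.card α - 2) := by
  have hn : 1 < Fintype.card α := Fintype.one_lt_card
  have h := sum_card_swapFactorizations_mul_orbitWeight (α := α) (Fintype.card α - 1)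
  have h1 : ∀ σ : Perm α, (if #(orbitFinsets σ) + (Fintype.card α - 1) = Fintype.card α then
      #(swapFactorizations (Fintype.card α - 1) σ) * orbitWeight σ else 0) =
      if σ.cycleType = {Fintype.card α} then
        (#(swapFactorizations (Fintype.card α - 1) c) * Fintype.card α : ℚ) else 0 := by
    intro σ
    have hiff : #(orbitFinsets σ) + (Fintype.card α - 1) = Fintype.card α ↔
        #(orbitFinsets σ) = 1 := by omega
    by_cases hσ : #(orbitFinsets σ) = 1
    · have hσ' := (card_orbitFinsets_eq_one_iff σ).1 hσ
      rw [if_pos (hiff.2 hσ), if_pos hσ', orbitWeight_of_card_orbitFinsets_eq_one hσ]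
      obtain ⟨g, rfl⟩ := isConj_iff.1 (isConj_iff_cycleType_eq.2 (hc.trans hσ'.symm))
      rw [card_swapFactorizations_conj]
    · rw [if_neg (mt hiff.1 hσ), if_neg (mt (card_orbitFinsets_eq_one_iff σ).2 hσ)]
  have h2 : ∏ i ∈ range (Fintype.card α - 1), ((Fintype.card α : ℚ) - i - 1) =
      (Fintype.card α - 1)! := by
    rw [← prod_range_add_one_eq_factorial, ← prod_range_reflect, Nat.cast_prod]
    refine prod_congr rfl fun i hi => ?_
    have := mem_range.1 hi
    rw [show Fintype.card α - 1 - 1 - i = Fintype.card α - (i + 2) by omega,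
      Nat.cast_sub (by omega)]
    push_cast
    ring
  rw [Fintype.sum_congr _ _ h1, ← sum_filter, sum_const, card_of_cycleType_singleton hn le_rfl,
    Nat.choose_self, mul_one, prod_mul_distrib, prod_const, card_range, h2, nsmul_eq_mul,
    show Fintype.card α - 1 = Fintype.card α - 2 + 1 by omega, pow_succ] at h
  rw [show Fintype.card α - 1 = Fintype.card α - 2 + 1 by omega]
  have hpos : (Fintype.card α : ℚ) ≠ 0 := by positivity
  have h3 : (((Fintype.card α - 2 + 1)! * #(swapFactorizations (Fintype.card α - 2 + 1) c) : ℕ) : ℚ)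
      = ((Fintype.card α - 2 + 1)! * Fintype.card α ^ (Fintype.card α - 2) : ℕ) := by
    push_cast
    apply mul_right_cancel₀ hpos
    linarith
  exact_mod_cast h3

theorem card_swapFactorizations_of_cycleType [Nontrivial α] {c : Perm α}
    (hc : c.cycleType = {Fintype.card α}) :
    #(swapFactorizations (Fintype.card α - 1) c) = Fintype.card α ^ (Fintype.card α - 2) :=
  Nat.eq_of_mul_eq_mul_left (Nat.factorial_pos _) (factorial_mul_card_swapFactorizations hc)

end

/-- Dénes' theorem: the number of minimal factorizations of the long cycle `(1,2,…,n)` into a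
product of `n - 1` transpositions is `n^(n-2)`. -/
theorem card_minimal_transposition_factorizations (n : ℕ) (hn : 1 ≤ n) :
    Set.ncard {t : Fin (n - 1) → Equiv.Perm (Fin n) |
        (List.ofFn t).prod = finRotate n ∧ ∀ i, (t i).IsSwap} = n ^ (n - 2) := by
  have key : {t : Fin (n - 1) → Equiv.Perm (Fin n) |
      (List.ofFn t).prod = finRotate n ∧ ∀ i, (t i).IsSwap} =
      ↑(swapFactorizations (n - 1) (finRotate n)) := by
    ext t
    rw [Finset.mem_coe, mem_swapFactorizations, Set.mem_ofPred_eq]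
    convert Iff.rfl
  rw [key, Set.ncard_coe_finset]
  obtain rfl | h := hn.eq_or_lt
  · rw [card_swapFactorizations_zero, if_pos (Subsingleton.elim _ _)]
    rfl
  · have : Nontrivial (Fin n) := Fin.nontrivial_iff_two_le.2 h
    have hc := card_swapFactorizations_of_cycleType (c := finRotate n)
      (by rw [Fintype.card_fin]; convert cycleType_finRotate_of_le h)
    rwa [Fintype.card_fin] at hc
end
end

section
/- Let n ≥ 1. Then, as an identity of polynomials in X_1,…,X_{n−1} with integer coefficients, Σ_{T ∈ A_n} ∏_{i : h_i(T) > 1} ( (h_i(T) − 1)·X_{i−1} + 2 ) = ∏_{i=1}^{n−1} ( i·X_i + (n+1−i) ), where A_n is the set of André trees on n vertices and h_i(T) is the hook length of the vertex labelled i in T. -/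
open scoped Classical

noncomputable section

/-- André trees on `m + 1` vertices, encoded by the parent map `p` on the vertex set
`Fin (m+1)` (vertex `v` carries the label `v + 1`, so the root is `Fin.last m`, with label
`m + 1`): labels decrease from the root towards the leaves (`j < p j` for every non-root
vertex `j`), every vertex has at most two (unordered) children, and we normalize
`p root = root`. -/
def andreTrees (m : ℕ) : Set (Fin (m + 1) → Fin (m + 1)) :=
  {p | p (Fin.last m) = Fin.last m ∧ (∀ j, j ≠ Fin.last m → j < p j) ∧
    ∀ v, Set.ncard {j | p j = v ∧ j ≠ Fin.last m} ≤ 2}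

/-- The hook length of the vertex `v` in the tree with parent map `p`: the number of
vertices of the subtree rooted at `v` (including `v` itself). -/
def hookLength {m : ℕ} (p : Fin (m + 1) → Fin (m + 1)) (v : Fin (m + 1)) : ℕ :=
  Set.ncard {j : Fin (m + 1) | ∃ k : ℕ, p^[k] j = v}

/-- The weight of an André tree: the product over the vertices `v` whose hook length `h` is
`> 1` of `(h - 1)·X_{label(v) - 1} + 2` (the label of `v : Fin (m+1)` being `v + 1`). -/
def wtAndre {m : ℕ} (p : Fin (m + 1) → Fin (m + 1)) : MvPolynomial ℕ ℤ :=
  ∏ v : Fin (m + 1),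
    if 1 < hookLength p v then
      MvPolynomial.C ((hookLength p v : ℤ) - 1) * MvPolynomial.X v.val + 2
    else 1

/-- The non-root vertices whose parent is `v`. -/
def children {m : ℕ} (p : Fin (m + 1) → Fin (m + 1)) (v : Fin (m + 1)) :
    Finset (Fin (m + 1)) :=
  Finset.univ.filter fun j => p j = v ∧ j ≠ Fin.last m

theorem mem_children {m : ℕ} {p : Fin (m + 1) → Fin (m + 1)} {v j : Fin (m + 1)} :
    j ∈ children p v ↔ p j = v ∧ j ≠ Fin.last m := by
  simp [children]

/-- The vertices of the subtree rooted at `v`. -/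
def descendants {m : ℕ} (p : Fin (m + 1) → Fin (m + 1)) (v : Fin (m + 1)) :
    Finset (Fin (m + 1)) :=
  Finset.univ.filter fun j => ∃ k : ℕ, p^[k] j = v

theorem mem_descendants {m : ℕ} {p : Fin (m + 1) → Fin (m + 1)} {v j : Fin (m + 1)} :
    j ∈ descendants p v ↔ ∃ k : ℕ, p^[k] j = v := by
  simp [descendants]

theorem hookLength_eq_card {m : ℕ} (p : Fin (m + 1) → Fin (m + 1)) (v : Fin (m + 1)) :
    hookLength p v = (descendants p v).card := by
  rw [hookLength, ← Set.ncard_coe_finset]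
  simp [descendants]

/-- Parent maps increase strictly away from the root, which they fix. -/
def IsParentMap {m : ℕ} (p : Fin (m + 1) → Fin (m + 1)) : Prop :=
  p (Fin.last m) = Fin.last m ∧ ∀ j, j ≠ Fin.last m → j < p j

namespace IsParentMap

variable {m : ℕ} {p : Fin (m + 1) → Fin (m + 1)}

theorem le_apply (hp : IsParentMap p) (j : Fin (m + 1)) : j ≤ p j := by
  by_cases h : j = Fin.last m
  · rw [h, hp.1]
  · exact (hp.2 j h).le

theorem le_iterate (hp : IsParentMap p) (k : ℕ) (j : Fin (m + 1)) : j ≤ p^[k] j := by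
  induction k with
  | zero => simp
  | succ k ih =>
    rw [Function.iterate_succ_apply']
    exact ih.trans (hp.le_apply _)

theorem descendants_eq (hp : IsParentMap p) (v : Fin (m + 1)) :
    descendants p v = insert v ((children p v).biUnion (descendants p)) := by
  ext j
  simp only [mem_descendants, Finset.mem_insert, Finset.mem_biUnion, mem_children]
  constructor
  · rintro ⟨k, hk⟩
    induction k with
    | zero => exact Or.inl hk
    | succ k ih =>
      rw [Function.iterate_succ_apply'] at hk
      by_cases h : p^[k] j = Fin.last m
      · rw [h, hp.1] at hk
        exact ih (h.trans hk)
      · exact Or.inr ⟨_, ⟨hk, h⟩, k, rfl⟩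
  · rintro (rfl | ⟨c, ⟨hc, -⟩, k, hk⟩)
    · exact ⟨0, rfl⟩
    · exact ⟨k + 1, by rw [Function.iterate_succ_apply', hk, hc]⟩

theorem lt_of_mem_children (hp : IsParentMap p) {v c : Fin (m + 1)} (hc : c ∈ children p v) :
    c < v := by
  rw [mem_children] at hc
  exact hc.1 ▸ hp.2 c hc.2

theorem eq_of_iterate_eq (hp : IsParentMap p) {v c d j : Fin (m + 1)} (hc : c ∈ children p v)
    (hd : d ∈ children p v) {a b : ℕ} (hab : a ≤ b) (ha : p^[a] j = c) (hb : p^[b] j = d) :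
    c = d := by
  obtain ⟨e, rfl⟩ := Nat.exists_eq_add_of_le' hab
  rw [Function.iterate_add_apply, ha] at hb
  cases e with
  | zero => exact hb
  | succ e =>
    rw [Function.iterate_succ_apply, (mem_children.1 hc).1] at hb
    exact absurd (hb ▸ hp.le_iterate e v) (hp.lt_of_mem_children hd).not_ge

theorem hookLength_eq (hp : IsParentMap p) (v : Fin (m + 1)) :
    hookLength p v = 1 + ∑ c ∈ children p v, hookLength p c := by
  simp only [hookLength_eq_card]
  rw [hp.descendants_eq v, Finset.card_insert_of_notMem, Finset.card_biUnion, add_comm]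
  · intro c hc d hd hcd
    refine Finset.disjoint_left.2 fun j hj hj' => ?_
    obtain ⟨a, ha⟩ := mem_descendants.1 hj
    obtain ⟨b, hb⟩ := mem_descendants.1 hj'
    rcases le_total a b with h | h
    · exact hcd (hp.eq_of_iterate_eq hc hd h ha hb)
    · exact hcd (hp.eq_of_iterate_eq hd hc h hb ha).symm
  · simp only [Finset.mem_biUnion, not_exists, not_and]
    intro c hc hv
    obtain ⟨k, hk⟩ := mem_descendants.1 hv
    exact (hp.lt_of_mem_children hc).not_ge (hk ▸ hp.le_iterate k v)

theorem hookLength_pos (hp : IsParentMap p) (v : Fin (m + 1)) : 0 < hookLength p v := by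
  rw [hp.hookLength_eq]
  omega

theorem hookLength_last (hp : IsParentMap p) : hookLength p (Fin.last m) = m + 1 := by
  rw [hookLength_eq_card]
  have key : ∀ d : ℕ, ∀ j : Fin (m + 1), m - j.val = d → j ∈ descendants p (Fin.last m) := by
    intro d
    induction d using Nat.strong_induction_on with
    | _ d ih =>
      intro j hj
      by_cases h : j = Fin.last m
      · exact mem_descendants.2 ⟨0, h⟩
      · have hlt : j.val < (p j).val := hp.2 j h
        have hle := (p j).is_le
        obtain ⟨k, hk⟩ := mem_descendants.1 (ih _ (by omega) (p j) rfl)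
        exact mem_descendants.2 ⟨k + 1, hk⟩
  rw [Finset.eq_univ_of_forall fun j => key _ j rfl, Finset.card_fin]

end IsParentMap

/-- Forests on the vertices with value `< i`, encoded as partial parent maps on `Fin (m + 1)`:
the roots of the forest, and the vertices `≥ i`, are sent to `Fin.last m`. -/
structure IsForest {m : ℕ} (i : ℕ) (q : Fin (m + 1) → Fin (m + 1)) : Prop where
  isParentMap : IsParentMap q
  lt_of_ne : ∀ j, q j ≠ Fin.last m → (q j).val < i
  card_children_le : ∀ v : Fin (m + 1), v.val < i → (children q v).card ≤ 2

/-- The roots of a forest on the vertices `< i`. -/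
def roots {m : ℕ} (i : ℕ) (q : Fin (m + 1) → Fin (m + 1)) : Finset (Fin (m + 1)) :=
  Finset.univ.filter fun j => j.val < i ∧ q j = Fin.last m

theorem mem_roots {m i : ℕ} {q : Fin (m + 1) → Fin (m + 1)} {j : Fin (m + 1)} :
    j ∈ roots i q ↔ j.val < i ∧ q j = Fin.last m := by
  simp [roots]

/-- Make the elements of `s` children of `v`. -/
def attach {m : ℕ} (v : Fin (m + 1)) (s : Finset (Fin (m + 1)))
    (q : Fin (m + 1) → Fin (m + 1)) : Fin (m + 1) → Fin (m + 1) :=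
  fun j => if j ∈ s then v else q j

/-- Make all children of `v` into roots. -/
def detach {m : ℕ} (v : Fin (m + 1)) (q : Fin (m + 1) → Fin (m + 1)) :
    Fin (m + 1) → Fin (m + 1) :=
  fun j => if q j = v then Fin.last m else q j

namespace IsForest

variable {m : ℕ} {q : Fin (m + 1) → Fin (m + 1)}

theorem apply_eq_last_of_le {i : ℕ} (hq : IsForest i q) {j : Fin (m + 1)} (hj : i ≤ j.val) :
    q j = Fin.last m := by
  by_contra h
  have h1 := hq.lt_of_ne j h
  have h2 : j.val ≤ (q j).val := hq.isParentMap.le_apply j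
  omega

theorem children_eq_empty {i : ℕ} (hq : IsForest i q) {v : Fin (m + 1)} (hv : i ≤ v.val)
    (hv' : v ≠ Fin.last m) : children q v = ∅ := by
  refine Finset.eq_empty_of_forall_notMem fun j hj => ?_
  obtain ⟨rfl, -⟩ := mem_children.1 hj
  exact absurd (hq.lt_of_ne j hv') hv.not_gt

theorem sum_hookLength_roots {i : ℕ} (hi : i ≤ m) (hq : IsForest i q) :
    ∑ v ∈ roots i q, hookLength q v = i := by
  have h := hq.isParentMap.hookLength_eq (Fin.last m)
  have hsplit : children q (Fin.last m) =
      roots i q ∪ Finset.univ.filter fun j : Fin (m + 1) => i ≤ j.val ∧ j.val < m := by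
    ext j
    simp only [mem_children, Finset.mem_union, mem_roots, Finset.mem_filter, Finset.mem_univ,
      true_and, ← Fin.lt_last_iff_ne_last, Fin.lt_def, Fin.val_last]
    constructor
    · rintro ⟨h1, h2⟩
      exact (lt_or_ge j.val i).imp (fun h => ⟨h, h1⟩) fun h => ⟨h, h2⟩
    · rintro (⟨h1, h2⟩ | ⟨h1, h2⟩)
      · exact ⟨h2, h1.trans_le hi⟩
      · exact ⟨hq.apply_eq_last_of_le h1, h2⟩
  have hdisj : Disjoint (roots i q)
      (Finset.univ.filter fun j : Fin (m + 1) => i ≤ j.val ∧ j.val < m) := by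
    rw [Finset.disjoint_left]
    simp only [mem_roots, Finset.mem_filter, Finset.mem_univ, true_and]
    omega
  have hone : ∀ j ∈ Finset.univ.filter fun j : Fin (m + 1) => i ≤ j.val ∧ j.val < m,
      hookLength q j = 1 := by
    intro j hj
    simp only [Finset.mem_filter, Finset.mem_univ, true_and] at hj
    rw [hq.isParentMap.hookLength_eq, hq.children_eq_empty hj.1]
    · simp
    · rw [Ne, Fin.ext_iff, Fin.val_last]
      omega
  have hcard : (Finset.univ.filter fun j : Fin (m + 1) => i ≤ j.val ∧ j.val < m).card = m - i := by
    rw [← Nat.card_Ico, ← Finset.card_map Fin.valEmbedding]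
    congr 1
    ext a
    simp only [Finset.mem_map, Finset.mem_filter, Finset.mem_univ, true_and,
      Fin.valEmbedding_apply, Finset.mem_Ico]
    exact ⟨by rintro ⟨b, hb, rfl⟩; exact hb, fun ha => ⟨⟨a, by omega⟩, ha, rfl⟩⟩
  rw [hq.isParentMap.hookLength_last, hsplit, Finset.sum_union hdisj, Finset.sum_congr rfl hone,
    Finset.sum_const, hcard] at h
  simp only [smul_eq_mul, mul_one] at h
  omega

variable {v : Fin (m + 1)} {s : Finset (Fin (m + 1))}

theorem children_attach_self (hq : IsForest v.val q) (hv : v ≠ Fin.last m)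
    (hs : s ⊆ roots v.val q) : children (attach v s q) v = s := by
  ext j
  rw [mem_children, attach]
  constructor
  · rintro ⟨h, -⟩
    split_ifs at h with hj
    · exact hj
    · exact absurd (hq.lt_of_ne j (h ▸ hv)) (by rw [h]; exact lt_irrefl _)
  · intro hj
    rw [if_pos hj]
    refine ⟨rfl, ?_⟩
    rintro rfl
    exact absurd (mem_roots.1 (hs hj)).1 (Fin.le_last v).not_gt

theorem children_attach_of_lt (hs : s ⊆ roots v.val q) {u : Fin (m + 1)} (hu : u < v) :
    children (attach v s q) u = children q u := by
  ext j
  rw [mem_children, mem_children, attach]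
  split_ifs with hj
  · rw [(mem_roots.1 (hs hj)).2]
    simp [hu.ne', (hu.trans_le (Fin.le_last v)).ne']
  · rfl

theorem isParentMap_attach (hq : IsForest v.val q) (hs : s ⊆ roots v.val q) :
    IsParentMap (attach v s q) := by
  constructor
  · rw [attach, if_neg, hq.isParentMap.1]
    intro h
    exact absurd (mem_roots.1 (hs h)).1 (Fin.le_last v).not_gt
  · intro j hj
    rw [attach]
    split_ifs with h
    · exact (mem_roots.1 (hs h)).1
    · exact hq.isParentMap.2 j hj

theorem attach (hq : IsForest v.val q) (hv : v ≠ Fin.last m) (hs : s ⊆ roots v.val q)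
    (hcard : s.card ≤ 2) : IsForest (v.val + 1) (attach v s q) where
  isParentMap := hq.isParentMap_attach hs
  lt_of_ne j hj := by
    rw [_root_.attach] at hj ⊢
    split_ifs at hj ⊢
    · exact Nat.lt_succ_self _
    · exact (hq.lt_of_ne j hj).trans (Nat.lt_succ_self _)
  card_children_le u hu := by
    rcases (Nat.lt_succ_iff.1 hu).lt_or_eq with h | h
    · rw [children_attach_of_lt hs h]
      exact hq.card_children_le u h
    · rw [Fin.ext h, hq.children_attach_self hv hs]
      exact hcard

theorem hookLength_attach_of_lt (hq : IsForest v.val q) (hs : s ⊆ roots v.val q)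
    {u : Fin (m + 1)} (hu : u < v) : hookLength (_root_.attach v s q) u = hookLength q u := by
  induction u using WellFoundedLT.induction with
  | _ u ih =>
    have hp := hq.isParentMap_attach hs
    rw [hp.hookLength_eq, hq.isParentMap.hookLength_eq, children_attach_of_lt hs hu]
    congr 1
    refine Finset.sum_congr rfl fun c hc => ?_
    have hcu := hq.isParentMap.lt_of_mem_children hc
    exact ih c hcu (hcu.trans hu)

theorem hookLength_attach_self (hq : IsForest v.val q) (hv : v ≠ Fin.last m)
    (hs : s ⊆ roots v.val q) :
    hookLength (_root_.attach v s q) v = 1 + ∑ c ∈ s, hookLength q c := by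
  rw [(hq.isParentMap_attach hs).hookLength_eq, hq.children_attach_self hv hs]
  congr 1
  exact Finset.sum_congr rfl fun c hc => hq.hookLength_attach_of_lt hs (mem_roots.1 (hs hc)).1

theorem roots_attach (hq : IsForest v.val q) (hv : v ≠ Fin.last m) (hs : s ⊆ roots v.val q) :
    roots (v.val + 1) (_root_.attach v s q) = insert v (roots v.val q \ s) := by
  have hvs : v ∉ s := fun h => lt_irrefl _ (mem_roots.1 (hs h)).1
  ext j
  rw [mem_roots, Finset.mem_insert, Finset.mem_sdiff, mem_roots, _root_.attach]
  by_cases hj : j ∈ s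
  · have hjv : j ≠ v := fun h => hvs (h ▸ hj)
    simp [hj, hv, hjv]
  · rw [if_neg hj, Nat.lt_succ_iff, le_iff_lt_or_eq, ← Fin.ext_iff]
    simp only [hj, not_false_eq_true, and_true]
    constructor
    · rintro ⟨h | h, h'⟩
      · exact Or.inr ⟨h, h'⟩
      · exact Or.inl h
    · rintro (rfl | ⟨h, h'⟩)
      · exact ⟨Or.inr rfl, hq.apply_eq_last_of_le le_rfl⟩
      · exact ⟨Or.inl h, h'⟩

theorem card_roots_attach (hq : IsForest v.val q) (hv : v ≠ Fin.last m)
    (hs : s ⊆ roots v.val q) :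
    (roots (v.val + 1) (_root_.attach v s q)).card = (roots v.val q).card + 1 - s.card := by
  have hle := Finset.card_le_card hs
  rw [hq.roots_attach hv hs, Finset.card_insert_of_notMem, Finset.card_sdiff_of_subset hs]
  · omega
  · intro h
    exact lt_irrefl _ (mem_roots.1 (Finset.mem_sdiff.1 h).1).1

theorem detach_attach (hq : IsForest v.val q) (hv : v ≠ Fin.last m) (hs : s ⊆ roots v.val q) :
    detach v (_root_.attach v s q) = q := by
  funext j
  rw [detach, _root_.attach]
  by_cases hj : j ∈ s
  · simp [hj, (mem_roots.1 (hs hj)).2]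
  · rw [if_neg hj, if_neg]
    intro h
    exact absurd (hq.lt_of_ne j (h ▸ hv)) (by rw [h]; exact lt_irrefl _)

theorem attach_detach (hq : IsForest (v.val + 1) q) (hv : v ≠ Fin.last m) :
    _root_.attach v (children q v) (detach v q) = q := by
  funext j
  have hlast := hq.isParentMap.1
  simp only [_root_.attach, detach, mem_children]
  by_cases hj : q j = v
  · have : j ≠ Fin.last m := by
      rintro rfl
      exact hv (hj.symm.trans hlast)
    simp [hj, this]
  · simp [hj]

theorem detach (hq : IsForest (v.val + 1) q) (hv : v ≠ Fin.last m) :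
    IsForest v.val (detach v q) where
  isParentMap := by
    refine ⟨?_, fun j hj => ?_⟩
    · rw [_root_.detach, hq.isParentMap.1, if_neg hv.symm]
    · rw [_root_.detach]
      split_ifs
      · exact Fin.lt_last_iff_ne_last.2 hj
      · exact hq.isParentMap.2 j hj
  lt_of_ne j hj := by
    rw [_root_.detach] at hj ⊢
    split_ifs at hj ⊢ with h
    · exact absurd rfl hj
    · exact lt_of_le_of_ne (Nat.lt_succ_iff.1 (hq.lt_of_ne j hj)) fun h' => h (Fin.ext h')
  card_children_le u hu := by
    refine le_trans (Finset.card_le_card fun j hj => ?_) (hq.card_children_le u (by omega))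
    rw [mem_children, _root_.detach] at hj
    rw [mem_children]
    split_ifs at hj
    · exact absurd (hj.1 ▸ hu) (Fin.le_last v).not_gt
    · exact hj

theorem children_subset_roots_detach (hq : IsForest (v.val + 1) q) :
    children q v ⊆ roots v.val (_root_.detach v q) := fun j hj => by
  rw [mem_roots, _root_.detach, if_pos (mem_children.1 hj).1]
  exact ⟨hq.isParentMap.lt_of_mem_children hj, rfl⟩

end IsForest

/-- The finset of all forests on the vertices `< i`. -/
def forests (m i : ℕ) : Finset (Fin (m + 1) → Fin (m + 1)) :=
  Finset.univ.filter (IsForest i)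

theorem mem_forests {m i : ℕ} {q : Fin (m + 1) → Fin (m + 1)} :
    q ∈ forests m i ↔ IsForest i q := by
  simp [forests]

theorem sum_forests_succ {m : ℕ} {M : Type*} [AddCommMonoid M] {v : Fin (m + 1)}
    (hv : v ≠ Fin.last m) (F : (Fin (m + 1) → Fin (m + 1)) → M) :
    ∑ q ∈ forests m (v.val + 1), F q =
      ∑ q ∈ forests m v.val,
        ∑ s ∈ (roots v.val q).powerset.filter (fun s => s.card ≤ 2), F (attach v s q) := by
  rw [Finset.sum_sigma']
  symm
  refine Finset.sum_bij' (fun x _ => attach v x.2 x.1) (fun q _ => ⟨detach v q, children q v⟩)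
    ?_ ?_ ?_ ?_ ?_
  · rintro ⟨q, s⟩ h
    simp only [Finset.mem_sigma, mem_forests, Finset.mem_filter, Finset.mem_powerset] at h
    exact mem_forests.2 (h.1.attach hv h.2.1 h.2.2)
  · intro q h
    rw [mem_forests] at h
    simp only [Finset.mem_sigma, mem_forests, Finset.mem_filter, Finset.mem_powerset]
    exact ⟨h.detach hv, h.children_subset_roots_detach, h.card_children_le v (Nat.lt_succ_self _)⟩
  · rintro ⟨q, s⟩ h
    simp only [Finset.mem_sigma, mem_forests, Finset.mem_filter, Finset.mem_powerset] at h
    simp only [h.1.detach_attach hv h.2.1, h.1.children_attach_self hv h.2.1]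
  · intro q h
    exact (mem_forests.1 h).attach_detach hv
  · intros
    rfl

theorem sum_powersetCard_two {α R : Type*} [DecidableEq α] [CommRing R] (t : Finset α)
    (h : α → R) :
    ∑ s ∈ t.powersetCard 2, ∑ c ∈ s, h c = ((t.card : R) - 1) * ∑ c ∈ t, h c := by
  induction t using Finset.induction_on with
  | empty =>
    rw [Finset.powersetCard_eq_empty.2 (by simp)]
    simp
  | insert a t ha ih =>
    rw [Finset.powersetCard_succ_insert ha, Finset.sum_union, ih, Finset.sum_image,
      Finset.powersetCard_one, Finset.sum_map, Finset.sum_insert ha,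
      Finset.card_insert_of_notMem ha]
    · have : ∀ b ∈ t, ∑ c ∈ insert a ({b} : Finset α), h c = h a + h b := fun b hb => by
        rw [Finset.sum_insert, Finset.sum_singleton]
        exact fun hab => ha (Finset.mem_singleton.1 hab ▸ hb)
      simp only [Function.Embedding.coeFn_mk]
      rw [Finset.sum_congr rfl this, Finset.sum_add_distrib, Finset.sum_const, nsmul_eq_mul]
      push_cast
      ring
    · intro s hs s' hs' hss
      have hn : ∀ u ∈ t.powersetCard 1, a ∉ u := fun u hu hau =>
        ha ((Finset.mem_powersetCard.1 hu).1 hau)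
      rw [← Finset.erase_insert (hn s hs), ← Finset.erase_insert (hn s' hs')]
      exact congrArg (fun u => u.erase a) hss
    · rw [Finset.disjoint_left]
      intro s hs hs'
      obtain ⟨u, -, rfl⟩ := Finset.mem_image.1 hs'
      exact ha ((Finset.mem_powersetCard.1 hs).1 (Finset.mem_insert_self a u))

theorem sum_card_le_two {α R : Type*} [DecidableEq α] [CommRing R] (t : Finset α)
    (h : α → R) (g : ℕ → R) (x : R) :
    ∑ s ∈ t.powerset.filter (fun s => s.card ≤ 2),
        (if s = ∅ then 1 else (∑ c ∈ s, h c) * x + 2) * g s.card =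
      g 0 + ((∑ c ∈ t, h c) * x + 2 * t.card) * g 1 +
        ((t.card - 1) * ((∑ c ∈ t, h c) * x + t.card)) * g 2 := by
  have hunion : t.powerset.filter (fun s => s.card ≤ 2) =
      (Finset.range 3).biUnion fun k => t.powersetCard k := by
    ext s
    simp only [Finset.mem_filter, Finset.mem_powerset, Finset.mem_biUnion, Finset.mem_range,
      Finset.mem_powersetCard, Nat.lt_succ_iff]
    exact ⟨fun h => ⟨_, h.2, h.1, rfl⟩, fun ⟨k, hk, hs, hc⟩ => ⟨hs, hc ▸ hk⟩⟩
  have hpos : ∀ k : ℕ, 0 < k → ∑ s ∈ t.powersetCard k,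
      (if s = ∅ then 1 else (∑ c ∈ s, h c) * x + 2) * g s.card =
      ((∑ s ∈ t.powersetCard k, ∑ c ∈ s, h c) * x + 2 * (t.card.choose k : R)) * g k := by
    intro k hk
    rw [Finset.sum_mul, mul_comm (2 : R), ← Finset.card_powersetCard, ← nsmul_eq_mul,
      ← Finset.sum_const, ← Finset.sum_add_distrib, Finset.sum_mul]
    refine Finset.sum_congr rfl fun s hs => ?_
    have hc := (Finset.mem_powersetCard.1 hs).2
    rw [hc, if_neg]
    rintro rfl
    simp at hc
    omega
  have hchoose : 2 * (t.card.choose 2 : R) = t.card * (t.card - 1) := by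
    rw [← Nat.cast_descFactorial_two, Nat.descFactorial_eq_factorial_mul_choose]
    push_cast [Nat.factorial]
    ring
  rw [hunion, Finset.sum_biUnion, Finset.sum_range_succ, Finset.sum_range_succ,
    Finset.sum_range_succ, Finset.sum_range_zero, hpos 1 one_pos, hpos 2 two_pos,
    sum_powersetCard_two, hchoose]
  · simp [Finset.powersetCard_one]
    ring
  · exact (Finset.pairwise_disjoint_powersetCard t).set_pairwise _

theorem cast_descFactorial_succ {R : Type*} [CommRing R] (s j : ℕ) :
    (s.descFactorial (j + 1) : R) = (s - j) * s.descFactorial j := by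
  rw [Nat.descFactorial_succ]
  rcases le_or_gt j s with h | h
  · push_cast [Nat.cast_sub h]
    rfl
  · simp [Nat.descFactorial_of_lt h]

theorem descFactorial_recurrence {R : Type*} [CommRing R] (s k : ℕ) (hk : 0 < k) (y : R) :
    (s.descFactorial k : R) + (y + 2 * k) * s.descFactorial (k - 1) +
        ((k - 1) * (y + k)) * s.descFactorial (k - 2) =
      (s + 1).descFactorial (k - 1) * (y + (s + 2)) := by
  rcases k with _ | _ | j
  · omega
  · simp
    ring
  · rw [show j + 1 + 1 - 1 = j + 1 from rfl, show j + 1 + 1 - 2 = j from rfl,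
      Nat.succ_descFactorial_succ, cast_descFactorial_succ s (j + 1), cast_descFactorial_succ s j]
    push_cast
    ring

/-- The factor contributed by the vertex `v` to the weight of a tree. -/
def vertexWeight {m : ℕ} (p : Fin (m + 1) → Fin (m + 1)) (v : Fin (m + 1)) :
    MvPolynomial ℕ ℤ :=
  if 1 < hookLength p v then
    MvPolynomial.C ((hookLength p v : ℤ) - 1) * MvPolynomial.X v.val + 2
  else 1

/-- The weight of a forest on the vertices `< i`. -/
def forestWeight {m : ℕ} (i : ℕ) (q : Fin (m + 1) → Fin (m + 1)) : MvPolynomial ℕ ℤ :=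
  ∏ v ∈ Finset.univ.filter (fun v : Fin (m + 1) => v.val < i), vertexWeight q v

theorem forestWeight_succ {m : ℕ} (v : Fin (m + 1)) (q : Fin (m + 1) → Fin (m + 1)) :
    forestWeight (v.val + 1) q = vertexWeight q v * forestWeight v.val q := by
  have : Finset.univ.filter (fun u : Fin (m + 1) => u.val < v.val + 1) =
      insert v (Finset.univ.filter fun u : Fin (m + 1) => u.val < v.val) := by
    ext u
    simp [le_iff_eq_or_lt, Fin.ext_iff]
  rw [forestWeight, this, Finset.prod_insert (by simp), forestWeight]

/-- The factor indexed by `i` in the product formula. -/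
def hookFactor (m i : ℕ) : MvPolynomial ℕ ℤ :=
  MvPolynomial.C (i : ℤ) * MvPolynomial.X i + MvPolynomial.C (((m + 1 : ℕ) : ℤ) + 1 - i)

/-- The total weight of all ways to complete a forest on the vertices `< i` with `k` roots to
an André tree. -/
def completionWeight (m i k : ℕ) : MvPolynomial ℕ ℤ :=
  ((m + 1 - i).descFactorial (k - 1) : MvPolynomial ℕ ℤ) * ∏ j ∈ Finset.Icc i m, hookFactor m j

theorem IsForest.vertexWeight_attach {m : ℕ} {q : Fin (m + 1) → Fin (m + 1)} {v : Fin (m + 1)}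
    {s : Finset (Fin (m + 1))} (hq : IsForest v.val q) (hv : v ≠ Fin.last m)
    (hs : s ⊆ roots v.val q) :
    vertexWeight (_root_.attach v s q) v =
      if s = ∅ then 1
      else (∑ c ∈ s, (hookLength q c : MvPolynomial ℕ ℤ)) * MvPolynomial.X v.val + 2 := by
  rw [vertexWeight, hq.hookLength_attach_self hv hs]
  rcases s.eq_empty_or_nonempty with rfl | hne
  · simp
  · have hpos : 0 < ∑ c ∈ s, hookLength q c :=
      Finset.sum_pos (fun c _ => hq.isParentMap.hookLength_pos c) hne
    rw [if_pos (by omega), if_neg hne.ne_empty]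
    simp

theorem IsForest.forestWeight_attach {m : ℕ} {q : Fin (m + 1) → Fin (m + 1)} {v : Fin (m + 1)}
    {s : Finset (Fin (m + 1))} (hq : IsForest v.val q) (hs : s ⊆ roots v.val q) :
    forestWeight v.val (_root_.attach v s q) = forestWeight v.val q := by
  refine Finset.prod_congr rfl fun u hu => ?_
  rw [vertexWeight, vertexWeight, hq.hookLength_attach_of_lt hs (Finset.mem_filter.1 hu).2]

theorem IsForest.sum_attach {m : ℕ} {q : Fin (m + 1) → Fin (m + 1)} {v : Fin (m + 1)}
    (hq : IsForest v.val q) (hv : v ≠ Fin.last m) (hv0 : 0 < v.val) :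
    ∑ s ∈ (roots v.val q).powerset.filter (fun s => s.card ≤ 2),
        forestWeight (v.val + 1) (_root_.attach v s q) *
          completionWeight m (v.val + 1) (roots (v.val + 1) (_root_.attach v s q)).card =
      forestWeight v.val q * completionWeight m v.val (roots v.val q).card := by
  have hvm : v.val < m := Fin.lt_last_iff_ne_last.2 hv
  have hsum := hq.sum_hookLength_roots hvm.le
  set k := (roots v.val q).card with hkdef
  have hk : 0 < k := by
    refine Finset.card_pos.2 (Finset.nonempty_iff_ne_empty.2 fun h => ?_)
    rw [h, Finset.sum_empty] at hsum
    omega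
  have hterm : ∀ s ∈ (roots v.val q).powerset.filter (fun s => s.card ≤ 2),
      forestWeight (v.val + 1) (_root_.attach v s q) *
          completionWeight m (v.val + 1) (roots (v.val + 1) (_root_.attach v s q)).card =
        forestWeight v.val q * ((if s = ∅ then 1 else
          (∑ c ∈ s, (hookLength q c : MvPolynomial ℕ ℤ)) * MvPolynomial.X v.val + 2) *
          completionWeight m (v.val + 1) (k + 1 - s.card)) := by
    intro s hs
    have hs' := Finset.mem_powerset.1 (Finset.mem_filter.1 hs).1
    rw [forestWeight_succ, hq.vertexWeight_attach hv hs', hq.forestWeight_attach hs',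
      hq.card_roots_attach hv hs']
    ring
  rw [Finset.sum_congr rfl hterm, ← Finset.mul_sum,
    sum_card_le_two _ _ (fun d => completionWeight m (v.val + 1) (k + 1 - d)), ← Nat.cast_sum,
    hsum, ← hkdef]
  congr 1
  obtain ⟨r, hr⟩ := Nat.exists_eq_add_of_lt hvm
  have hrec := descFactorial_recurrence (r + 1) k hk
    ((v.val : MvPolynomial ℕ ℤ) * MvPolynomial.X v.val)
  have hfactor : hookFactor m v.val =
      (v.val : MvPolynomial ℕ ℤ) * MvPolynomial.X v.val + (((r + 1 : ℕ) : MvPolynomial ℕ ℤ) + 2) := by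
    have : ((m + 1 : ℕ) : ℤ) + 1 - v.val = ((r + 1 : ℕ) : ℤ) + 2 := by omega
    rw [hookFactor, this]
    simp
  have hprod : ∏ j ∈ Finset.Icc v.val m, hookFactor m j =
      hookFactor m v.val * ∏ j ∈ Finset.Icc (v.val + 1) m, hookFactor m j := by
    rw [← Finset.insert_Icc_add_one_left_eq_Icc hvm.le, Finset.prod_insert (by simp)]
  simp only [completionWeight]
  rw [hprod, hfactor, show m + 1 - (v.val + 1) = r + 1 by omega,
    show m + 1 - v.val = r + 1 + 1 by omega, show k + 1 - 0 - 1 = k by omega,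
    show k + 1 - 1 - 1 = k - 1 by omega, show k + 1 - 2 - 1 = k - 2 by omega]
  linear_combination (∏ j ∈ Finset.Icc (v.val + 1) m, hookFactor m j) * hrec

theorem sum_forests_eq {m : ℕ} (i : ℕ) (hi : 1 ≤ i) (him : i ≤ m) :
    ∑ q ∈ forests m i, forestWeight i q * completionWeight m i (roots i q).card =
      ∏ j ∈ Finset.Icc 1 m, hookFactor m j := by
  induction i, hi using Nat.le_induction with
  | base =>
    have hlast : forests m 1 = {fun _ => Fin.last m} := by
      ext q
      rw [mem_forests, Finset.mem_singleton]
      constructor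
      · intro hq
        funext j
        by_contra h
        have h1 := hq.lt_of_ne j h
        have hj : j ≠ Fin.last m := by
          rintro rfl
          exact h hq.isParentMap.1
        have h2 : j.val < (q j).val := hq.isParentMap.2 j hj
        omega
      · rintro rfl
        refine ⟨⟨rfl, fun j hj => Fin.lt_last_iff_ne_last.2 hj⟩, fun j hj => absurd rfl hj,
          fun v hv => ?_⟩
        rw [children, Finset.filter_false_of_mem]
        · simp
        · rintro j - ⟨h, -⟩
          rw [← h, Fin.val_last] at hv
          omega
    have hq : IsForest 1 (fun _ : Fin (m + 1) => Fin.last m) := by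
      rw [← mem_forests, hlast, Finset.mem_singleton]
    have hroots : roots 1 (fun _ : Fin (m + 1) => Fin.last m) = {0} := by
      ext j
      rw [mem_roots, Finset.mem_singleton, Nat.lt_one_iff, Fin.val_eq_zero_iff]
      exact and_iff_left rfl
    have hweight : forestWeight 1 (fun _ : Fin (m + 1) => Fin.last m) = 1 := by
      refine Finset.prod_eq_one fun u hu => ?_
      have hu' : u ∈ roots 1 (fun _ : Fin (m + 1) => Fin.last m) :=
        mem_roots.2 ⟨(Finset.mem_filter.1 hu).2, rfl⟩
      have hsum := hq.sum_hookLength_roots him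
      rw [hroots, Finset.sum_singleton] at hsum
      rw [hroots, Finset.mem_singleton] at hu'
      rw [vertexWeight, hu', hsum, if_neg (lt_irrefl 1)]
    rw [hlast, Finset.sum_singleton, hroots, hweight]
    simp [completionWeight]
  | succ i hi ih =>
    have hv : (⟨i, by omega⟩ : Fin (m + 1)) ≠ Fin.last m := by
      rw [Ne, Fin.ext_iff, Fin.val_last]
      simp only
      omega
    rw [sum_forests_succ (v := ⟨i, by omega⟩) hv, ← ih (by omega)]
    exact Finset.sum_congr rfl fun q hq => (mem_forests.1 hq).sum_attach hv hi

theorem mem_andreTrees_iff {m : ℕ} {p : Fin (m + 1) → Fin (m + 1)} :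
    p ∈ andreTrees m ↔ IsForest m p ∧ (roots m p).card ≤ 2 := by
  have hcard : ∀ v, Set.ncard {j | p j = v ∧ j ≠ Fin.last m} = (children p v).card := fun v => by
    rw [← Set.ncard_coe_finset]
    simp [children]
  have hroots : roots m p = children p (Fin.last m) := by
    ext j
    rw [mem_roots, mem_children, ← Fin.lt_last_iff_ne_last, and_comm]
    rfl
  simp only [andreTrees, Set.mem_ofPred_eq, hcard, hroots]
  constructor
  · rintro ⟨h1, h2, h3⟩
    exact ⟨⟨⟨h1, h2⟩, fun j hj => Fin.lt_last_iff_ne_last.2 hj, fun v _ => h3 v⟩, h3 _⟩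
  · rintro ⟨⟨⟨h1, h2⟩, -, h3⟩, h4⟩
    refine ⟨h1, h2, fun v => ?_⟩
    by_cases hv : v = Fin.last m
    · exact hv ▸ h4
    · exact h3 v (Fin.lt_last_iff_ne_last.2 hv)

theorem wtAndre_eq_of_isForest {m : ℕ} (hm : 0 < m) {p : Fin (m + 1) → Fin (m + 1)}
    (hp : IsForest m p) : wtAndre p = forestWeight m p * hookFactor m m := by
  have hall : wtAndre p = forestWeight (m + 1) p := by
    rw [forestWeight, Finset.filter_true_of_mem fun v _ => v.is_lt]
    rfl
  have hsucc := forestWeight_succ (Fin.last m) p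
  rw [Fin.val_last] at hsucc
  rw [hall, hsucc, mul_comm, vertexWeight, hp.isParentMap.hookLength_last,
    if_pos (by omega), hookFactor, Fin.val_last]
  congr 2
  · congr 2
    push_cast
    ring
  · have : ((m + 1 : ℕ) : ℤ) + 1 - m = 2 := by omega
    rw [this]
    rfl

theorem finsum_andreTrees {m : ℕ} (hm : 0 < m) :
    ∑ᶠ p ∈ andreTrees m, wtAndre p =
      ∑ q ∈ forests m m, forestWeight m q * completionWeight m m (roots m q).card := by
  have hset : andreTrees m =
      ((forests m m).filter (fun q => (roots m q).card ≤ 2) : Finset _) := by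
    ext p
    simp [mem_andreTrees_iff, mem_forests]
  rw [hset, finsum_mem_coe_finset, Finset.sum_filter]
  refine Finset.sum_congr rfl fun q hq => ?_
  rw [mem_forests] at hq
  simp only [completionWeight, Finset.Icc_self, Finset.prod_singleton, Nat.add_sub_cancel_left]
  split_ifs with h
  · rw [wtAndre_eq_of_isForest hm hq]
    interval_cases (roots m q).card <;> simp
  · rw [Nat.descFactorial_of_lt (by omega)]
    simp

/-- The multivariate hook length formula for André trees (Theorem 4.4):
`Σ_{T ∈ A_n} ∏_{i : h_i(T) > 1} ((h_i(T) - 1) X_{i-1} + 2) = ∏_{i=1}^{n-1} (i X_i + (n+1-i))`. -/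
theorem andre_hook_formula (n m : ℕ) (hn : 1 ≤ n) (hnm : n = m + 1) :
    ∑ᶠ p ∈ andreTrees m, wtAndre p =
      ∏ i ∈ Finset.Icc 1 (n - 1),
        (MvPolynomial.C (i : ℤ) * MvPolynomial.X i + MvPolynomial.C ((n : ℤ) + 1 - i)) := by
  subst hnm
  rw [Nat.add_sub_cancel]
  rcases Nat.eq_zero_or_pos m with rfl | hm
  · have : Subsingleton (Fin (0 + 1)) := inferInstanceAs (Subsingleton (Fin 1))
    have hset : andreTrees 0 = {id} := by
      ext p
      rw [Set.mem_singleton_iff]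
      refine ⟨fun _ => Subsingleton.elim _ _, ?_⟩
      rintro rfl
      refine ⟨rfl, fun j hj => absurd (Subsingleton.elim _ _) hj, fun v => ?_⟩
      have hempty : {j : Fin (0 + 1) | id j = v ∧ j ≠ Fin.last 0} = ∅ :=
        Set.eq_empty_of_forall_notMem fun j hj => hj.2 (Subsingleton.elim _ _)
      rw [hempty, Set.ncard_empty]
      exact Nat.zero_le 2
    have hid : IsParentMap (id : Fin (0 + 1) → Fin (0 + 1)) :=
      ⟨rfl, fun j hj => absurd (Subsingleton.elim _ _) hj⟩
    rw [hset, finsum_mem_singleton]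
    have hone : hookLength (id : Fin (0 + 1) → Fin (0 + 1)) 0 = 1 := hid.hookLength_last
    simp [wtAndre, hone]
  · exact (finsum_andreTrees hm).trans (sum_forests_eq m hm le_rfl)
end
end

section
/- Let n ≥ 2. Consider all functions p : {1,…,n−1} → {1,…,n} such that for every j ∈ {1,…,n−1}, iterating p starting from j eventually reaches n (equivalently, the graph on vertex set {1,…,n} with edges {j, p(j)} for 1 ≤ j ≤ n−1 is a tree: these are exactly the Cayley trees on n vertices rooted at n, with p the parent map). Then, as an identity of polynomials in X_1,…,X_{n−2} with integer coefficients, Σ_p ∏_{j : p(j) < j} X_{j−1} = ∏_{i=1}^{n−2} ( i·X_i + (n − i) ). -/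
open scoped Classical

noncomputable section

/-- The `v`-th row of the reduced Laplacian contributed by an edge `v → u`, the row of the root `r`
being replaced by a standard basis row. -/
def edgeRow {V : Type*} [DecidableEq V] (R : Type*) [CommRing R] (r v u : V) : V → R :=
  if v = r then Pi.single r 1 else Pi.single v 1 - Pi.single u 1

theorem edgeRow_dotProduct {V R : Type*} [DecidableEq V] [Fintype V] [CommRing R]
    (r v u : V) (x : V → R) :
    edgeRow R r v u ⬝ᵥ x = if v = r then x r else x v - x u := by
  unfold edgeRow
  split_ifs <;> simp [sub_dotProduct]

theorem det_edgeRow_of_reaches {V R : Type*} [DecidableEq V] [Fintype V] [CommRing R]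
    (r : V) (p : V → V) (h : ∀ j, ∃ k : ℕ, p^[k] j = r) :
    (Matrix.of fun v => edgeRow R r v (p v)).det = 1 := by
  let d : V → ℕ := fun j => Nat.find (h j)
  have d_lt : ∀ v, v ≠ r → d (p v) < d v := by
    intro v hv
    have hs : p^[d v] v = r := Nat.find_spec (h v)
    obtain ⟨k, hk⟩ : ∃ k, d v = k + 1 := by
      refine Nat.exists_eq_succ_of_ne_zero fun h0 => hv ?_
      simpa [h0] using hs
    rw [hk, Function.iterate_succ_apply] at hs
    have : d (p v) ≤ k := Nat.find_min' (h (p v)) hs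
    omega
  have key : ∀ i j, d i ≤ d j → i ≠ j → edgeRow R r i (p i) j = 0 := by
    intro i j hij hne
    unfold edgeRow
    split_ifs with hi
    · subst hi
      simp [hne.symm]
    · have : j ≠ p i := by
        rintro rfl
        exact absurd (d_lt i hi) (not_lt.mpr hij)
      simp [hne.symm, this]
  have hdiag : ∀ i, edgeRow R r i (p i) i = 1 := by
    intro i
    unfold edgeRow
    split_ifs with hi
    · simp [hi]
    · have : i ≠ p i := fun e => absurd (d_lt i hi) (by rw [← e]; exact lt_irrefl _)
      simp [this]
  have htri : (Matrix.of fun v => edgeRow R r v (p v)).BlockTriangular (OrderDual.toDual ∘ d) := by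
    intro i j hij
    have hlt : d i < d j := hij
    exact key i j hlt.le fun e => by simp [e] at hlt
  rw [htri.det]
  refine Finset.prod_eq_one fun a _ => ?_
  have hone : (Matrix.of fun v => edgeRow R r v (p v)).toSquareBlock (OrderDual.toDual ∘ d) a =
      1 := ?_
  · rw [hone, Matrix.det_one]
  ext ⟨i, hi⟩ ⟨j, hj⟩
  rw [Matrix.toSquareBlock_def]
  by_cases e : i = j
  · subst e
    simpa using hdiag i
  · have hd : d i = d j := OrderDual.toDual.injective (hi.trans hj.symm)
    simpa [Matrix.one_apply, e] using key i j hd.le e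

theorem det_edgeRow_of_not_reaches {V R : Type*} [DecidableEq V] [Fintype V] [CommRing R]
    [IsDomain R] (r : V) (p : V → V) (h : ¬ ∀ j, ∃ k : ℕ, p^[k] j = r) :
    (Matrix.of fun v => edgeRow R r v (p v)).det = 0 := by
  classical
  push Not at h
  obtain ⟨j, hj⟩ := h
  refine Matrix.exists_mulVec_eq_zero_iff.mp
    ⟨fun v => if ∃ k : ℕ, p^[k] v = r then 0 else 1, fun h0 => ?_, ?_⟩
  · have := congrFun h0 j
    simp [hj] at this
  · ext v
    change edgeRow R r v (p v) ⬝ᵥ _ = 0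
    rw [edgeRow_dotProduct]
    by_cases hv : v = r
    · rw [if_pos hv, if_pos ⟨0, rfl⟩]
    · have : (∃ k : ℕ, p^[k] v = r) ↔ ∃ k : ℕ, p^[k] (p v) = r := by
        constructor
        · rintro ⟨_ | k, hk⟩
          · exact absurd hk hv
          · exact ⟨k, hk⟩
        · rintro ⟨k, hk⟩
          exact ⟨k + 1, hk⟩
      simp only [hv, if_false, this, sub_self]

/-- Directed weighted matrix-tree theorem, with parent maps as trees. -/
theorem det_sum_smul_edgeRow {V R : Type*} [DecidableEq V] [Fintype V] [CommRing R] [IsDomain R]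
    (r : V) (c : V → V → R) :
    (Matrix.of fun v => ∑ u, c v u • edgeRow R r v u).det =
      ∑ p : V → V, open Classical in
        if ∀ j, ∃ k : ℕ, p^[k] j = r then ∏ v, c v (p v) else 0 := by
  have h := (Matrix.detRowAlternating (R := R) (n := V)).toMultilinearMap.map_sum
    fun v u => c v u • edgeRow R r v u
  refine h.trans (Finset.sum_congr rfl fun p _ => ?_)
  rw [MultilinearMap.map_smul_univ, smul_eq_mul]
  change _ * (Matrix.of fun v => edgeRow R r v (p v)).det = _
  split_ifs with hp
  · rw [det_edgeRow_of_reaches r p hp, mul_one]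
  · rw [det_edgeRow_of_not_reaches r p hp, mul_zero]

/-- Weight of the edge `v → u`; the only edge allowed out of the root is its loop. -/
def decreasingWeight {R : Type*} [CommRing R] {m : ℕ} (X : Fin (m + 1) → R) (v u : Fin (m + 1)) :
    R :=
  if v = Fin.last m then if u = Fin.last m then 1 else 0 else if u < v then X v else 1

theorem laplacian_dotProduct {R : Type*} [CommRing R] {m : ℕ} (X : Fin (m + 1) → R)
    (v : Fin (m + 1)) (x : Fin (m + 1) → R) :
    (∑ u, decreasingWeight X v u • edgeRow R (Fin.last m) v u) ⬝ᵥ x =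
      if v = Fin.last m then x v else ∑ u, (if u < v then X v else 1) * (x v - x u) := by
  simp only [sum_dotProduct, smul_dotProduct, edgeRow_dotProduct, decreasingWeight, smul_eq_mul]
  split_ifs with hv
  · simp [hv]
  · rfl

theorem sum_weight_mul_sub_indicator {R : Type*} [CommRing R] {m : ℕ} (a : R)
    (v k : Fin (m + 1)) :
    ∑ u : Fin (m + 1), (if u < v then a else 1) *
        ((if k ≤ v then 1 else 0) - (if k ≤ u then 1 else 0)) =
      if k ≤ v then (k : ℕ) * a else -((m : R) + 1 - (k : ℕ)) := by
  split_ifs with hk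
  · trans ∑ u : Fin (m + 1), if u < k then a else 0
    · refine Finset.sum_congr rfl fun u _ => ?_
      by_cases hu : k ≤ u
      · simp [hu, not_lt.mpr hu]
      · simp [hu, not_le.mp hu, (not_le.mp hu).trans_le hk]
    · rw [← Finset.sum_filter]
      simp [Finset.filter_gt_eq_Iio]
  · trans ∑ u : Fin (m + 1), if k ≤ u then (-1 : R) else 0
    · refine Finset.sum_congr rfl fun u _ => ?_
      by_cases hu : k ≤ u
      · have : ¬ u < v := fun h => hk (hu.trans h.le)
        simp [hu, this]
      · simp [hu]
    · rw [← Finset.sum_filter]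
      simp [Finset.filter_le_eq_Ici, Nat.cast_sub k.2.le]

theorem det_laplacian {R : Type*} [CommRing R] {m : ℕ} (hm : m ≠ 0) (X : Fin (m + 1) → R) :
    (Matrix.of fun v => ∑ u, decreasingWeight X v u • edgeRow R (Fin.last m) v u).det =
      ∏ k : Fin (m + 1), if k = 0 ∨ k = Fin.last m then 1 else
        (k : ℕ) * X k + ((m : R) + 1 - (k : ℕ)) := by
  let L : Matrix (Fin (m + 1)) (Fin (m + 1)) R :=
    Matrix.of fun v => ∑ u, decreasingWeight X v u • edgeRow R (Fin.last m) v u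
  have hlast : (0 : Fin (m + 1)) ≠ Fin.last m := by
    simpa [Fin.ext_iff] using hm.symm
  let V : Matrix (Fin (m + 1)) (Fin (m + 1)) R := Matrix.of fun j k =>
    if k = 0 then if j = Fin.last m then 0 else 1 else if k ≤ j then 1 else 0
  let W : Matrix (Fin (m + 1)) (Fin (m + 1)) R := Matrix.of fun j k =>
    (if j = k then 1 else 0) +
      if j = 0 then if k = 0 then 0 else (m : R) + 1 - (k : ℕ) else 0
  let P : Matrix (Fin (m + 1)) (Fin (m + 1)) R := Matrix.of fun v k =>
    if v = Fin.last m then if k = 0 then 0 else 1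
    else if k = 0 then 1 else if k ≤ v then (k : ℕ) * X v else -((m : R) + 1 - (k : ℕ))
  have hLV : L * V = P := by
    ext v k
    change (∑ u, decreasingWeight X v u • edgeRow R (Fin.last m) v u) ⬝ᵥ (fun j => V j k) = _
    rw [laplacian_dotProduct]
    simp only [V, P, Matrix.of_apply]
    by_cases hv : v = Fin.last m
    · simp [hv, Fin.le_last]
    · by_cases hk : k = 0
      · have hlt : ¬ Fin.last m < v := not_lt.mpr (Fin.le_last v)
        have : ∀ u, (1 : R) - (if u = Fin.last m then 0 else 1) =
            if u = Fin.last m then 1 else 0 := fun u => by split_ifs <;> simp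
        simp [hv, hk, this, hlt]
      · simp only [hv, hk, if_false]
        exact sum_weight_mul_sub_indicator (X v) v k
  have hV : V.det = 1 := by
    rw [Matrix.det_of_isLowerTriangular V]
    · refine Finset.prod_eq_one fun i _ => ?_
      by_cases hi : i = 0
      · simp [V, hi, hlast]
      · simp [V, hi]
    · intro i j hij
      have hij : i < j := hij
      have : j ≠ 0 := (bot_le.trans_lt hij).ne'
      simp [V, this, hij]
  have hW : W.det = 1 := by
    rw [Matrix.det_of_isUpperTriangular]
    · refine Finset.prod_eq_one fun i _ => ?_
      by_cases hi : i = 0 <;> simp [W, hi]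
    · intro i j hij
      have hij : j < i := hij
      have : i ≠ 0 := (bot_le.trans_lt hij).ne'
      simp [W, this, hij.ne']
  have hPW : ∀ v k, (P * W) v k =
      P v k + P v 0 * if k = 0 then 0 else (m : R) + 1 - (k : ℕ) := by
    intro v k
    simp [Matrix.mul_apply, W, mul_add, Finset.sum_add_distrib]
  have hdet : L.det = (P * W).det := by
    rw [← hLV, Matrix.det_mul, Matrix.det_mul, hV, hW, mul_one, mul_one]
  rw [hdet, Matrix.det_of_isLowerTriangular]
  · refine Finset.prod_congr rfl fun k _ => ?_
    rw [hPW]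
    by_cases hk : k = 0
    · simp [P, hk, hlast]
    · by_cases hk' : k = Fin.last m
      · simp [P, hk', hlast.symm]
      · simp [P, hk, hk']
  · intro i j hij
    have hij : i < j := hij
    have h0 : j ≠ 0 := (bot_le.trans_lt hij).ne'
    have hi : i ≠ Fin.last m := (hij.trans_le (Fin.le_last j)).ne
    rw [hPW]
    simp [P, h0, hi, not_le.mpr hij]

/-- Kreweras–Moszkowski: the generating function of Cayley trees on `n` vertices (encoded by
their parent maps `p : Fin (m+1) → Fin (m+1)`, `n = m + 1`, rooted at the largest vertex
`Fin.last m`, with the normalization `p root = root`) by decreasing edges, where a vertex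
`v` (carrying label `v + 1`) with `p v < v` contributes a factor `X_{label(v) - 1} = X_v`, is
`∏_{i=1}^{n-2} (i X_i + (n - i))`. -/
theorem cayley_decreasing_edges (n m : ℕ) (hn : 2 ≤ n) (hnm : n = m + 1) :
    ∑ᶠ p ∈ {p : Fin (m + 1) → Fin (m + 1) |
        p (Fin.last m) = Fin.last m ∧ ∀ j, ∃ k : ℕ, p^[k] j = Fin.last m},
      (∏ v : Fin (m + 1),
        if p v < v then (MvPolynomial.X v.val : MvPolynomial ℕ ℤ) else 1) =
      ∏ i ∈ Finset.Icc 1 (n - 2),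
        (MvPolynomial.C (i : ℤ) * MvPolynomial.X i + MvPolynomial.C ((n : ℤ) - i)) := by
  subst hnm
  obtain ⟨l, rfl⟩ : ∃ l, m = l + 1 := ⟨m - 1, by omega⟩
  have key := (det_sum_smul_edgeRow (Fin.last (l + 1)) (decreasingWeight
    fun v : Fin (l + 1 + 1) => (MvPolynomial.X v.val : MvPolynomial ℕ ℤ))).symm.trans
      (det_laplacian (Nat.succ_ne_zero l) _)
  rw [finsum_mem_def, finsum_eq_sum_of_fintype]
  refine Eq.trans (Finset.sum_congr rfl fun p _ => ?_) (key.trans ?_)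
  · simp only [Set.indicator_apply, Set.mem_ofPred_eq]
    by_cases hr : p (Fin.last (l + 1)) = Fin.last (l + 1)
    · simp only [hr, true_and]
      by_cases hp : ∀ j, ∃ k : ℕ, p^[k] j = Fin.last (l + 1)
      swap
      · rw [if_neg hp, if_neg hp]
      rw [if_pos hp, if_pos hp]
      refine Finset.prod_congr rfl fun v _ => ?_
      by_cases hv : v = Fin.last (l + 1)
      · simp [decreasingWeight, hv, hr]
      · simp [decreasingWeight, hv]
    · have h0 : ∏ v, decreasingWeight
          (fun v : Fin (l + 1 + 1) => (MvPolynomial.X v.val : MvPolynomial ℕ ℤ)) v (p v) = 0 :=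
        Finset.prod_eq_zero (Finset.mem_univ (Fin.last (l + 1))) (by simp [decreasingWeight, hr])
      simp [hr, h0]
  · rw [Fin.prod_univ_succ, Fin.prod_univ_castSucc]
    have hs : Finset.Icc 1 (l + 1 + 1 - 2) = Finset.Ico 1 (l + 1) := by
      ext; simp
    rw [hs, Finset.prod_Ico_eq_prod_range, Finset.prod_range]
    simp only [Fin.succ_last, or_true, true_or, if_true, one_mul, mul_one]
    refine Finset.prod_congr (by simp) fun i _ => ?_
    have h1 : (i.castSucc.succ : Fin (l + 1 + 1)) ≠ Fin.last (l + 1) := by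
      simp [Fin.ext_iff, i.2.ne]
    simp [h1, Fin.succ_ne_zero, add_comm]
end
end
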